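/- arXiv:1912.03532 — 2 statements merged into one kernel-verified Lean document; each statement's English description precedes it below -/
import Mathlib

section
/- Let Ω be an open set of finite Lebesgue measure in ℝⁿ, n ≥ 2, let m ∈ ℕ with m < n, set p = n/m, and let d ∈ (0, n]. Let μ be a finite Borel measure on Ω satisfying sup_{x ∈ ℝⁿ, r > 0} μ(B_r(x) ∩ Ω)/r^d < ∞. Then there exists a constant C (depending on n, m, d, Ω and μ) such that for every u ∈ C_c^∞(Ω): ( ∫₀¹ ( t^{−m/n} (log(e/t))^{−1} u*_μ(μ(Ω)·t) )^{n/m} dt )^{m/n} ≤ C ( ∫_Ω |∇^m u(x)|^{n/m} dx )^{m/n}, i.e. ‖u‖_{L^{∞,n/m;−1}(Ω,μ)} ≤ C ‖∇^m u‖_{L^{n/m}(Ω)}. (This is a Brézis–Wainger type inequality for d-Frostman measures in the limiting case p = n/m.) -/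
open MeasureTheory Set
open scoped ENNReal NNReal

/-- The non-increasing rearrangement of a real-valued function with respect to a measure. -/
noncomputable def rearr {α : Type*} [MeasurableSpace α] (ν : MeasureTheory.Measure α)
    (u : α → ℝ) (s : ℝ) : ℝ≥0∞ :=
  sInf {ρ : ℝ≥0∞ | ν {x | ρ < ENNReal.ofReal |u x|} ≤ ENNReal.ofReal s}

theorem exists_setLIntegral_rpow_norm_sub_le {E : Type*} [NormedAddCommGroup E]
    [MeasurableSpace E] [BorelSpace E] (ν : Measure E) {A d γ : ℝ} (hA : 0 ≤ A) (hγ : 0 < γ)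
    (hγd : γ < d)
    (hν : ∀ (x : E) (r : ℝ), 0 < r → ν (Metric.ball x r) ≤ ENNReal.ofReal (A * r ^ d)) :
    ∃ C : ℝ≥0, ∀ (x : E) (S : Set E), ν S ≠ ⊤ →
      ∫⁻ y in S, ENNReal.ofReal (‖x - y‖ ^ (-γ)) ∂ν ≤ C * ν S ^ (1 - γ / d) := by
  have hd : 0 < d := hγ.trans hγd
  have hq : 1 < d / γ := (one_lt_div hγ).2 hγd
  have hγd' : 0 < 1 - γ / d := by
    rw [sub_pos, div_lt_one hd]; exact hγd
  refine ⟨(1 + A / (d / γ - 1)).toNNReal, fun x S hS ↦ ?_⟩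
  rcases eq_or_ne (ν S) 0 with h0 | h0
  · simp [Measure.restrict_eq_zero.2 h0]
  set σ := (ν S).toReal with hσ
  have hσ0 : 0 < σ := ENNReal.toReal_pos h0 hS
  have hσS : ν S = ENNReal.ofReal σ := (ENNReal.ofReal_toReal hS).symm
  set Λ := σ ^ (-γ / d) with hΛ
  have hΛ0 : 0 < Λ := Real.rpow_pos_of_pos hσ0 _
  have hmeas : AEMeasurable (fun y ↦ ‖x - y‖ ^ (-γ)) (ν.restrict S) := by
    have : Continuous fun y : E ↦ ‖x - y‖ := by fun_prop
    exact (this.measurable.pow_const _).aemeasurable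
  rw [lintegral_eq_lintegral_meas_lt _ (Filter.Eventually.of_forall fun y ↦ by positivity) hmeas,
    ← Ioc_union_Ioi_eq_Ioi hΛ0.le,
    lintegral_union measurableSet_Ioi (Ioc_disjoint_Ioi le_rfl)]
  have h1 : ∫⁻ t in Ioc 0 Λ, (ν.restrict S) {a | t < ‖x - a‖ ^ (-γ)} ≤ ENNReal.ofReal (σ * Λ) := by
    calc _ ≤ ∫⁻ t in Ioc 0 Λ, ν S := by
          refine lintegral_mono fun t ↦ ?_
          exact (measure_mono (subset_univ _)).trans (by simp)
      _ = _ := by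
          rw [setLIntegral_const, Real.volume_Ioc, sub_zero, hσS, ENNReal.ofReal_mul hσ0.le]
  have h2 : ∫⁻ t in Ioi Λ, (ν.restrict S) {a | t < ‖x - a‖ ^ (-γ)} ≤
      ENNReal.ofReal (A * (Λ ^ (1 - d / γ) / (d / γ - 1))) := by
    calc _ ≤ ∫⁻ t in Ioi Λ, ENNReal.ofReal (A * t ^ (-(d / γ))) := by
          refine setLIntegral_mono' measurableSet_Ioi fun t ht ↦ ?_
          have ht0 : 0 < t := hΛ0.trans ht
          refine (Measure.restrict_apply_le _ _).trans ?_
          calc ν {a | t < ‖x - a‖ ^ (-γ)} ≤ ν (Metric.ball x (t ^ (-γ⁻¹))) := by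
                refine measure_mono fun y hy ↦ ?_
                have hy : t < ‖x - y‖ ^ (-γ) := hy
                rw [Metric.mem_ball, dist_comm, dist_eq_norm]
                have hn : 0 < ‖x - y‖ := by
                  rcases (norm_nonneg (x - y)).eq_or_lt with h | h
                  · rw [← h, Real.zero_rpow (by linarith)] at hy; linarith
                  · exact h
                have := Real.rpow_lt_rpow_of_neg ht0 hy (z := -γ⁻¹) (by simpa using hγ)
                rwa [← Real.rpow_mul hn.le, neg_mul_neg, mul_inv_cancel₀ hγ.ne', Real.rpow_one] at this
            _ ≤ ENNReal.ofReal (A * (t ^ (-γ⁻¹)) ^ d) := hν _ _ (by positivity)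
            _ = _ := by
                rw [← Real.rpow_mul ht0.le]; congr 3; field_simp
      _ = _ := by
          have hi := integrableOn_Ioi_rpow_of_lt (a := -(d / γ)) (by linarith) hΛ0
          rw [← ofReal_integral_eq_lintegral_ofReal (hi.const_mul A), integral_const_mul,
            integral_Ioi_rpow_of_lt (by linarith) hΛ0]
          · congr 2
            rw [show -(d / γ) + 1 = -(d / γ - 1) by ring, neg_div_neg_eq]
            congr 2; ring
          · filter_upwards [ae_restrict_mem measurableSet_Ioi] with t ht
            have ht0 : 0 < t := hΛ0.trans ht
            simp only [Pi.zero_apply]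
            positivity
  refine (add_le_add h1 h2).trans (le_of_eq ?_)
  have e1 : σ * Λ = σ ^ (1 - γ / d) := by
    rw [hΛ, sub_eq_add_neg, Real.rpow_add hσ0, Real.rpow_one, neg_div]
  have e2 : Λ ^ (1 - d / γ) = σ ^ (1 - γ / d) := by
    rw [hΛ, ← Real.rpow_mul hσ0.le]; congr 1; field_simp; ring
  have hq' : 0 < d / γ - 1 := by linarith
  rw [← ENNReal.ofReal_add (by positivity) (by positivity), e1, e2, hσS,
    ENNReal.ofReal_rpow_of_pos hσ0, ← ENNReal.ofReal_coe_nnreal, Real.coe_toNNReal _ (by positivity),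
    ← ENNReal.ofReal_mul (by positivity)]
  congr 1; ring

theorem enorm_le_lintegral_Ioi_deriv {g : ℝ → ℝ} (hg : ContDiff ℝ 1 g)
    (hc : HasCompactSupport g) (r : ℝ) : ‖g r‖ₑ ≤ ∫⁻ s in Ioi r, ‖deriv g s‖ₑ := by
  rw [← enorm_neg, ← HasCompactSupport.integral_Ioi_deriv_eq hg hc r]
  exact enorm_integral_le_lintegral_enorm _

theorem lintegral_Ioo_pow_le (k : ℕ) {s : ℝ} (hs : 0 ≤ s) :
    ∫⁻ r in Ioo 0 s, ENNReal.ofReal (r ^ k) ≤ ENNReal.ofReal (s ^ (k + 1)) := by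
  calc _ ≤ ∫⁻ r in Ioo 0 s, ENNReal.ofReal (s ^ k) :=
        setLIntegral_mono' measurableSet_Ioo fun r hr ↦ by
          have := hr.1; have := hr.2.le; gcongr
    _ = _ := by
        rw [setLIntegral_const, Real.volume_Ioo, sub_zero, pow_succ, ENNReal.ofReal_mul (by positivity)]

theorem enorm_le_lintegral_pow_mul_iteratedDeriv {g : ℝ → ℝ} (hg : ContDiff ℝ (⊤ : ℕ∞) g)
    (hc : HasCompactSupport g) (k : ℕ) :
    ‖g 0‖ₑ ≤ ∫⁻ r in Ioi 0, ENNReal.ofReal (r ^ k) * ‖iteratedDeriv (k + 1) g r‖ₑ := by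
  have hsm : ∀ k : ℕ, ContDiff ℝ (⊤ : ℕ∞) (iteratedDeriv k g) := fun k ↦ by
    rw [iteratedDeriv_eq_iterate]
    exact hg.iterate_deriv k
  have hcs : ∀ k : ℕ, HasCompactSupport (iteratedDeriv k g) := fun k ↦ by
    rw [iteratedDeriv_eq_iterate]
    induction k with
    | zero => exact hc
    | succ k ih => rw [Function.iterate_succ_apply']; exact ih.deriv
  induction k with
  | zero =>
    simpa using enorm_le_lintegral_Ioi_deriv (hg.of_le (by simp)) hc 0
  | succ k ih =>
    refine ih.trans ?_
    have hm : Measurable fun s ↦ ‖iteratedDeriv (k + 2) g s‖ₑ :=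
      (hsm (k + 2)).continuous.measurable.enorm
    calc _ ≤ ∫⁻ r in Ioi 0, ENNReal.ofReal (r ^ k) * ∫⁻ s in Ioi r, ‖iteratedDeriv (k + 2) g s‖ₑ := by
          gcongr with r
          have := enorm_le_lintegral_Ioi_deriv ((hsm (k + 1)).of_le (by simp)) (hcs (k + 1)) r
          rwa [← iteratedDeriv_succ] at this
      _ = ∫⁻ r in Ioi 0, ∫⁻ s in Ioi 0, (Ioo 0 s).indicator (fun r ↦ ENNReal.ofReal (r ^ k)) r *
            ‖iteratedDeriv (k + 2) g s‖ₑ := by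
          refine setLIntegral_congr_fun measurableSet_Ioi fun r hr ↦ ?_
          have hr : 0 < r := hr
          rw [← lintegral_const_mul _ hm, ← lintegral_indicator measurableSet_Ioi,
            ← lintegral_indicator measurableSet_Ioi]
          congr 1 with s
          by_cases hs : r < s
          · simp [indicator, hs, hr, hr.trans hs]
          · simp [indicator, hs]
      _ = ∫⁻ s in Ioi 0, ∫⁻ r in Ioi 0, (Ioo 0 s).indicator (fun r ↦ ENNReal.ofReal (r ^ k)) r *
            ‖iteratedDeriv (k + 2) g s‖ₑ := by
          refine lintegral_lintegral_swap (Measurable.aemeasurable ?_)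
          refine Measurable.mul ?_ (hm.comp measurable_snd)
          have : MeasurableSet {q : ℝ × ℝ | 0 < q.1 ∧ q.1 < q.2} :=
            (measurableSet_lt measurable_const measurable_fst).inter
              (measurableSet_lt measurable_fst measurable_snd)
          exact Measurable.indicator (s := {q : ℝ × ℝ | 0 < q.1 ∧ q.1 < q.2})
            (f := fun q : ℝ × ℝ ↦ ENNReal.ofReal (q.1 ^ k)) (by fun_prop) this
      _ ≤ _ := by
          refine setLIntegral_mono' measurableSet_Ioi fun s hs ↦ ?_
          rw [lintegral_mul_const _ (Measurable.indicator (by fun_prop) measurableSet_Ioo)]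
          gcongr
          refine (setLIntegral_le_lintegral _ _).trans ?_
          rw [lintegral_indicator measurableSet_Ioo]
          exact lintegral_Ioo_pow_le k (le_of_lt hs)

theorem norm_iteratedDeriv_comp_line_le {E : Type*} [NormedAddCommGroup E] [NormedSpace ℝ E]
    {u : E → ℝ} (hu : ContDiff ℝ (⊤ : ℕ∞) u) (x z : E) (k : ℕ) (r : ℝ) :
    ‖iteratedDeriv k (fun r : ℝ ↦ u (x + r • z)) r‖ ≤
      ‖iteratedFDeriv ℝ k u (x + r • z)‖ * ‖z‖ ^ k := by
  have h := ContinuousLinearMap.iteratedFDeriv_comp_right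
    (ContinuousLinearMap.toSpanSingleton ℝ z) (f := fun y ↦ u (x + y)) (n := k)
    ((hu.comp (contDiff_const.add contDiff_id)).of_le (by exact_mod_cast le_top)) r le_rfl
  rw [← norm_iteratedFDeriv_eq_norm_iteratedDeriv]
  have e : (fun r : ℝ ↦ u (x + r • z)) =
      (fun y ↦ u (x + y)) ∘ (ContinuousLinearMap.toSpanSingleton ℝ z) := by
    ext r; simp
  rw [e, h, iteratedFDeriv_comp_add_left]
  refine (ContinuousMultilinearMap.norm_compContinuousLinearMap_le _ _).trans ?_
  simp

theorem ofReal_abs_le_lintegral_ray {E : Type*} [NormedAddCommGroup E] [NormedSpace ℝ E]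
    {u : E → ℝ} (hu : ContDiff ℝ (⊤ : ℕ∞) u) (hc : HasCompactSupport u) (x : E) {z : E}
    (hz : z ≠ 0) (k : ℕ) :
    ENNReal.ofReal |u x| ≤ ∫⁻ r in Ioi 0, ENNReal.ofReal (r ^ k) *
      ENNReal.ofReal (‖iteratedFDeriv ℝ (k + 1) u (x + r • z)‖ * ‖z‖ ^ (k + 1)) := by
  have hemb : Topology.IsClosedEmbedding fun r : ℝ ↦ x + r • z :=
    (Homeomorph.addLeft x).isClosedEmbedding.comp (isClosedEmbedding_smul_left hz)
  have h := enorm_le_lintegral_pow_mul_iteratedDeriv (g := fun r : ℝ ↦ u (x + r • z))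
    (hu.comp (by fun_prop)) (hc.comp_isClosedEmbedding hemb) k
  simp only [zero_smul, add_zero] at h
  rw [← Real.norm_eq_abs, ofReal_norm]
  refine h.trans ?_
  gcongr with r
  rw [← ofReal_norm]
  exact ENNReal.ofReal_le_ofReal (norm_iteratedDeriv_comp_line_le hu x z (k + 1) r)

theorem lintegral_shell_ray_le {E : Type*} [NormedAddCommGroup E] [NormedSpace ℝ E]
    [MeasurableSpace E] [BorelSpace E] [FiniteDimensional ℝ E] (ν : Measure E)
    [ν.IsAddHaarMeasure] {k : ℕ} (hk : k < Module.finrank ℝ E) {G : E → ℝ≥0∞}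
    (hG : Measurable G) :
    ∫⁻ z in {z : E | 1 < ‖z‖ ∧ ‖z‖ < 2}, (∫⁻ r in Ioi (0 : ℝ), ENNReal.ofReal (r ^ k) * G (r • z)) ∂ν ≤
      ENNReal.ofReal (2 ^ (Module.finrank ℝ E : ℝ)) *
        ∫⁻ w, G w * ENNReal.ofReal (‖w‖ ^ ((k + 1 : ℝ) - Module.finrank ℝ E)) ∂ν := by
  set n := Module.finrank ℝ E with hn
  set S : Set E := {z : E | 1 < ‖z‖ ∧ ‖z‖ < 2} with hS
  have hSm : MeasurableSet S :=
    (measurableSet_lt measurable_const measurable_norm).inter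
      (measurableSet_lt measurable_norm measurable_const)
  have hsub : (k : ℝ) - n < 0 := by rw [sub_neg]; exact_mod_cast hk
  rw [lintegral_lintegral_swap (Measurable.aemeasurable
    (by simp only [Function.uncurry_def]; fun_prop))]
  calc
    _ ≤ ∫⁻ r in Ioi (0 : ℝ), ∫⁻ w, (Ioo (‖w‖ / 2) ‖w‖).indicator
          (fun _ ↦ ENNReal.ofReal ((‖w‖ / 2) ^ ((k : ℝ) - n))) r * G w ∂ν := by
        refine setLIntegral_mono' measurableSet_Ioi fun r hr ↦ ?_
        have hr : 0 < r := hr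
        set H : E → ℝ≥0∞ := fun w ↦ S.indicator 1 (r⁻¹ • w) * G w with hH
        have hHm : Measurable H := by
          refine Measurable.mul ?_ hG
          exact (measurable_one.indicator hSm).comp (measurable_const_smul _)
        have e : ∫⁻ z in S, ENNReal.ofReal (r ^ k) * G (r • z) ∂ν =
            ENNReal.ofReal (r ^ k) * (ENNReal.ofReal |(r ^ n)⁻¹| * ∫⁻ w, H w ∂ν) := by
          rw [← smul_eq_mul (ENNReal.ofReal |(r ^ n)⁻¹|), ← lintegral_smul_measure,
            ← Measure.map_addHaar_smul ν hr.ne', lintegral_map hHm (measurable_const_smul r),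
            lintegral_const_mul' _ _ ENNReal.ofReal_ne_top,
            ← lintegral_indicator hSm]
          congr 2 with z
          simp only [hH, smul_smul, inv_mul_cancel₀ hr.ne', one_smul]
          by_cases hz : z ∈ S <;> simp [hz]
        rw [e, ← mul_assoc, ← lintegral_const_mul _ hHm]
        refine lintegral_mono fun w ↦ ?_
        simp only [hH, ← mul_assoc]
        gcongr
        by_cases hw : r⁻¹ • w ∈ S
        · obtain ⟨h1, h2⟩ := hw
          rw [norm_smul, norm_inv, Real.norm_of_nonneg hr.le, inv_mul_eq_div] at h1 h2
          rw [one_lt_div hr] at h1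
          rw [div_lt_iff₀ hr] at h2
          have hw0 : 0 < ‖w‖ := hr.trans h1
          rw [indicator_of_mem (show r ∈ Ioo (‖w‖ / 2) ‖w‖ from ⟨by linarith, h1⟩)]
          rw [← ENNReal.ofReal_mul (by positivity)]
          refine (mul_le_of_le_one_right' (indicator_le_self' (fun _ _ ↦ zero_le_one) _)).trans ?_
          refine ENNReal.ofReal_le_ofReal ?_
          rw [abs_of_pos (by positivity), ← div_eq_mul_inv, ← Real.rpow_natCast, ← Real.rpow_natCast,
            ← Real.rpow_sub hr]
          exact Real.rpow_le_rpow_of_nonpos (by positivity) (by linarith) hsub.le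
        · simp [hw]
    _ = ∫⁻ w, (∫⁻ r in Ioi (0 : ℝ), (Ioo (‖w‖ / 2) ‖w‖).indicator
          (fun _ ↦ ENNReal.ofReal ((‖w‖ / 2) ^ ((k : ℝ) - n))) r * G w) ∂ν := by
        refine lintegral_lintegral_swap (Measurable.aemeasurable ?_)
        refine Measurable.mul ?_ (hG.comp measurable_snd)
        have : MeasurableSet {q : ℝ × E | ‖q.2‖ / 2 < q.1 ∧ q.1 < ‖q.2‖} :=
          (measurableSet_lt (by fun_prop) measurable_fst).inter
            (measurableSet_lt measurable_fst (by fun_prop))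
        exact Measurable.indicator (s := {q : ℝ × E | ‖q.2‖ / 2 < q.1 ∧ q.1 < ‖q.2‖})
            (f := fun q : ℝ × E ↦ ENNReal.ofReal ((‖q.2‖ / 2) ^ ((k : ℝ) - n))) (by fun_prop) this
    _ ≤ _ := by
        rw [← lintegral_const_mul _ (by fun_prop)]
        refine lintegral_mono fun w ↦ ?_
        simp only
        rw [lintegral_mul_const _ (measurable_const.indicator measurableSet_Ioo), mul_left_comm, mul_comm]
        gcongr
        refine (setLIntegral_le_lintegral _ _).trans ?_
        rw [lintegral_indicator measurableSet_Ioo, setLIntegral_const, Real.volume_Ioo]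
        rcases (norm_nonneg w).eq_or_lt with h | h
        · simp [← h]
        rw [← ENNReal.ofReal_mul (by positivity), ← ENNReal.ofReal_mul (by positivity)]
        refine ENNReal.ofReal_le_ofReal ?_
        rw [sub_half, ← Real.rpow_add_one (by positivity), Real.div_rpow h.le (by norm_num),
          div_eq_inv_mul, ← Real.rpow_neg (by norm_num), show (k : ℝ) - n + 1 = k + 1 - n by ring]
        gcongr
        · norm_num
        · have : (0 : ℝ) ≤ k := by positivity
          linarith

theorem exists_abs_le_lintegral_riesz_iteratedFDeriv {E : Type*} [NormedAddCommGroup E]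
    [NormedSpace ℝ E] [MeasurableSpace E] [BorelSpace E] [FiniteDimensional ℝ E] (ν : Measure E)
    [ν.IsAddHaarMeasure] {m : ℕ} (hm : 1 ≤ m) (hmn : m ≤ Module.finrank ℝ E) :
    ∃ C : ℝ≥0, ∀ u : E → ℝ, ContDiff ℝ (⊤ : ℕ∞) u → HasCompactSupport u → ∀ x,
      ENNReal.ofReal |u x| ≤ C * ∫⁻ y, ENNReal.ofReal ‖iteratedFDeriv ℝ m u y‖ *
        ENNReal.ofReal (‖x - y‖ ^ ((m : ℝ) - Module.finrank ℝ E)) ∂ν := by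
  obtain ⟨k, rfl⟩ : ∃ k, m = k + 1 := ⟨m - 1, by omega⟩
  set n := Module.finrank ℝ E with hn
  have : Nontrivial E := Module.nontrivial_of_finrank_pos (R := ℝ) (by omega)
  set S : Set E := {z : E | 1 < ‖z‖ ∧ ‖z‖ < 2} with hS
  have hSo : IsOpen S := (isOpen_lt continuous_const continuous_norm).inter
    (isOpen_lt continuous_norm continuous_const)
  have hS0 : ν S ≠ 0 := by
    refine (hSo.measure_pos ν ?_).ne'
    obtain ⟨z, hz⟩ := exists_norm_eq E (c := 3 / 2) (by norm_num)
    exact ⟨z, by rw [hS, mem_ofPred_eq, hz]; norm_num⟩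
  have hSt : ν S ≠ ⊤ := by
    refine ((measure_mono fun z hz ↦ ?_).trans_lt (measure_ball_lt_top (x := (0 : E)) (r := 2))).ne
    simpa using hz.2
  have hCt : (ν S)⁻¹ * (ENNReal.ofReal (2 ^ (k + 1)) * ENNReal.ofReal (2 ^ (n : ℝ))) ≠ ⊤ := by
    finiteness
  refine ⟨ENNReal.toNNReal ((ν S)⁻¹ * (ENNReal.ofReal (2 ^ (k + 1)) *
    ENNReal.ofReal (2 ^ (n : ℝ)))), fun u hu hc x ↦ ?_⟩
  rw [ENNReal.coe_toNNReal hCt, mul_assoc, mul_comm, ← div_eq_mul_inv,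
    ENNReal.le_div_iff_mul_le (.inl hS0) (.inl hSt)]
  have hcont : Continuous fun y ↦ iteratedFDeriv ℝ (k + 1) u y :=
    hu.continuous_iteratedFDeriv (by exact_mod_cast le_top)
  have hfm : Measurable fun w ↦ ENNReal.ofReal ‖iteratedFDeriv ℝ (k + 1) u (x + w)‖ :=
    (ENNReal.continuous_ofReal.comp (hcont.comp (by fun_prop)).norm).measurable
  calc ENNReal.ofReal |u x| * ν S = ∫⁻ z in S, ENNReal.ofReal |u x| ∂ν := by
        rw [setLIntegral_const]
    _ ≤ ∫⁻ z in S, ENNReal.ofReal (2 ^ (k + 1)) * (∫⁻ r in Ioi (0 : ℝ), ENNReal.ofReal (r ^ k) *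
          ENNReal.ofReal ‖iteratedFDeriv ℝ (k + 1) u (x + r • z)‖) ∂ν := by
        refine setLIntegral_mono' hSo.measurableSet fun z hz ↦ ?_
        have hz0 : z ≠ 0 := by
          rintro rfl
          have := hz.1
          simp at this
          linarith
        refine (ofReal_abs_le_lintegral_ray hu hc x hz0 k).trans ?_
        rw [← lintegral_const_mul']
        · refine lintegral_mono fun r ↦ ?_
          rw [mul_left_comm, mul_comm (ENNReal.ofReal (2 ^ _)),
            ← ENNReal.ofReal_mul (norm_nonneg _)]
          gcongr
          exact hz.2.le
        · finiteness
    _ ≤ ENNReal.ofReal (2 ^ (k + 1)) * (ENNReal.ofReal (2 ^ (n : ℝ)) *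
          ∫⁻ w, ENNReal.ofReal ‖iteratedFDeriv ℝ (k + 1) u (x + w)‖ *
            ENNReal.ofReal (‖w‖ ^ ((k + 1 : ℝ) - n)) ∂ν) := by
        rw [lintegral_const_mul' _ _ (by finiteness)]
        gcongr
        exact lintegral_shell_ray_le ν (by omega) hfm
    _ = _ := by
        rw [← mul_assoc]
        congr 1
        rw [← lintegral_add_left_eq_self
          (fun y ↦ _ * ENNReal.ofReal (‖x - y‖ ^ (((k + 1 : ℕ) : ℝ) - n))) x]
        simp

theorem lintegral_Ioo_deriv_eq {g g' : ℝ → ℝ} {a b : ℝ} (hab : a ≤ b)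
    (hg : ContinuousOn g (Icc a b)) (hd : ∀ x ∈ Ioo a b, HasDerivAt g (g' x) x)
    (h0 : ∀ x ∈ Ioo a b, 0 ≤ g' x) :
    ∫⁻ x in Ioo a b, ENNReal.ofReal (g' x) = ENNReal.ofReal (g b - g a) := by
  have hi := intervalIntegral.integrableOn_deriv_of_nonneg hg hd h0
  have hi' := (intervalIntegrable_iff_integrableOn_Ioc_of_le hab).2 hi
  rw [← intervalIntegral.integral_eq_sub_of_hasDerivAt_of_le hab hg hd hi',
    intervalIntegral.integral_of_le hab, integral_Ioc_eq_integral_Ioo,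
    ofReal_integral_eq_lintegral_ofReal (hi.mono_set Ioo_subset_Ioc_self)]
  filter_upwards [ae_restrict_mem measurableSet_Ioo] with x hx using h0 x hx

theorem log_exp_one_div {t : ℝ} (ht : 0 < t) : Real.log (Real.exp 1 / t) = 1 - Real.log t := by
  rw [Real.log_div (Real.exp_ne_zero 1) ht.ne', Real.log_exp]

theorem one_le_log_exp_one_div {t : ℝ} (ht : 0 < t) (ht1 : t ≤ 1) :
    1 ≤ Real.log (Real.exp 1 / t) := by
  rw [log_exp_one_div ht]
  linarith [Real.log_nonpos ht.le ht1]

theorem lintegral_inv_mul_log_rpow_neg_half_le {h : ℝ} (hh : 1 ≤ h) :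
    ∫⁻ l in Ioo 1 h, ENNReal.ofReal (l⁻¹ * (1 + Real.log l) ^ (-(1 / 2) : ℝ)) ≤
      ENNReal.ofReal (2 * (1 + Real.log h) ^ (1 / 2 : ℝ)) := by
  have hpos : ∀ x : ℝ, 1 ≤ x → 0 < 1 + Real.log x := fun x hx ↦ by
    linarith [Real.log_nonneg hx]
  rw [lintegral_Ioo_deriv_eq (g := fun l ↦ 2 * (1 + Real.log l) ^ (1 / 2 : ℝ)) hh]
  · apply ENNReal.ofReal_le_ofReal
    simp
  · intro x hx
    have := (hpos x hx.1).ne'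
    have h2 : x ≠ 0 := by linarith [hx.1]
    refine ContinuousAt.continuousWithinAt ?_
    fun_prop (disch := simp_all)
  · intro x hx
    have h2 : x ≠ 0 := by linarith [hx.1]
    refine ((((Real.hasDerivAt_log h2).const_add 1).rpow_const (p := 1 / 2)
      (.inl (hpos x hx.1.le).ne')).const_mul 2).congr_deriv ?_
    rw [show (1 / 2 - 1 : ℝ) = -(1 / 2) by norm_num]
    ring
  · intro x hx
    have h1 := hpos x hx.1.le
    have h2 : 0 < x := by linarith [hx.1]
    positivity

theorem lintegral_inv_mul_log_rpow_le {β s : ℝ} (hβ : 0 < β) (hs : 0 < s) (hs1 : s ≤ 1) :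
    ∫⁻ t in Ioo 0 s, ENNReal.ofReal (t⁻¹ * Real.log (Real.exp 1 / t) ^ (-β - 1)) ≤
      ENNReal.ofReal (β⁻¹ * Real.log (Real.exp 1 / s) ^ (-β)) := by
  have hpos : ∀ t : ℝ, 0 < t → t ≤ s → 0 < Real.log (Real.exp 1 / t) := fun t h0 h1 ↦
    one_pos.trans_le (one_le_log_exp_one_div h0 (h1.trans hs1))
  rw [lintegral_Ioo_deriv_eq (g := fun t ↦ β⁻¹ * Real.log (Real.exp 1 / t) ^ (-β)) hs.le]
  · apply ENNReal.ofReal_le_ofReal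
    simp [Real.zero_rpow (neg_ne_zero.2 hβ.ne')]
  · intro x hx
    rcases hx.1.eq_or_lt with h | h
    · subst h
      have h0 : β⁻¹ * Real.log (Real.exp 1 / 0) ^ (-β) = β⁻¹ * 0 := by
        simp [Real.zero_rpow (neg_ne_zero.2 hβ.ne')]
      have : ContinuousWithinAt (fun t ↦ β⁻¹ * Real.log (Real.exp 1 / t) ^ (-β)) (Ioi 0) 0 := by
        rw [ContinuousWithinAt, h0]
        refine Filter.Tendsto.const_mul _ ((tendsto_rpow_neg_atTop hβ).comp
          (Real.tendsto_log_atTop.comp ?_))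
        change Filter.Tendsto (fun t ↦ Real.exp 1 * t⁻¹) _ _
        exact tendsto_inv_nhdsGT_zero.const_mul_atTop (Real.exp_pos 1)
      rw [← continuousWithinAt_insert_self] at this
      refine this.mono fun y hy ↦ ?_
      rcases hy.1.eq_or_lt with h | h
      · exact .inl h.symm
      · exact .inr h
    · have := (hpos x h hx.2).ne'
      have h2 : Real.exp 1 / x ≠ 0 := by positivity
      refine ContinuousAt.continuousWithinAt ?_
      have hx0 := h.ne'
      refine ContinuousAt.mul continuousAt_const (ContinuousAt.rpow_const ?_ (.inl this))
      exact (continuousAt_const.div continuousAt_id hx0).log h2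
  · intro x hx
    have h1 : HasDerivAt (fun t ↦ 1 - Real.log t) (-x⁻¹) x :=
      (Real.hasDerivAt_log hx.1.ne').const_sub 1
    have h2 : HasDerivAt (fun t ↦ Real.log (Real.exp 1 / t)) (-x⁻¹) x := by
      refine h1.congr_of_eventuallyEq ?_
      filter_upwards [lt_mem_nhds hx.1] with t ht using log_exp_one_div ht
    refine ((h2.rpow_const (p := -β) (.inl (hpos x hx.1 hx.2.le).ne')).const_mul
      β⁻¹).congr_deriv ?_
    field_simp
  · intro x hx
    have h1 := hpos x hx.1 hx.2.le
    have h2 := hx.1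
    positivity

theorem lintegral_Ioo_one_rpow_le {p h : ℝ} (hp : 1 < p) (hh : 1 ≤ h) {ψ : ℝ → ℝ≥0∞}
    (hψ : Measurable ψ) :
    (∫⁻ l in Ioo 1 h, ψ l) ^ p ≤
      (∫⁻ l in Ioo 1 h, ψ l ^ p *
        ENNReal.ofReal (l ^ (p - 1) * (1 + Real.log l) ^ ((p - 1) / 2))) *
        ENNReal.ofReal (2 * (1 + Real.log h) ^ (1 / 2 : ℝ)) ^ (p - 1) := by
  set q := p / (p - 1) with hq
  have hp0 : 0 < p := by linarith
  have hp1 : 0 < p - 1 := by linarith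
  have hpq : p.HolderConjugate q := Real.HolderConjugate.conjExponent hp
  have hq0 : 0 < q := hpq.symm.pos
  set w : ℝ → ℝ := fun l ↦ l * (1 + Real.log l) ^ (1 / 2 : ℝ) with hw
  have hwm : Measurable w := by fun_prop
  have hW : ∀ l ∈ Ioo 1 h, 0 < 1 + Real.log l := fun l hl ↦ by
    linarith [Real.log_nonneg hl.1.le]
  have hw0 : ∀ l ∈ Ioo 1 h, 0 < w l := fun l hl ↦ by
    have := hW l hl
    have : 0 < l := by linarith [hl.1]
    positivity
  have key := ENNReal.lintegral_mul_le_Lp_mul_Lq (volume.restrict (Ioo 1 h)) hpq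
    (f := fun l ↦ ψ l * ENNReal.ofReal (w l ^ (1 / q))) (g := fun l ↦ ENNReal.ofReal (w l ^ (-(1 / q))))
    (by fun_prop) (by fun_prop)
  have e1 : ∫⁻ l in Ioo 1 h, ψ l = ∫⁻ l in Ioo 1 h, ((fun l ↦ ψ l * ENNReal.ofReal (w l ^ (1 / q))) *
      fun l ↦ ENNReal.ofReal (w l ^ (-(1 / q)))) l := by
    refine setLIntegral_congr_fun measurableSet_Ioo fun l hl ↦ ?_
    have := hw0 l hl
    simp only [Pi.mul_apply]
    rw [mul_assoc, ← ENNReal.ofReal_mul (by positivity), ← Real.rpow_add this]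
    simp
  have e2 : ∫⁻ l in Ioo 1 h, (ψ l * ENNReal.ofReal (w l ^ (1 / q))) ^ p =
      ∫⁻ l in Ioo 1 h, ψ l ^ p *
        ENNReal.ofReal (l ^ (p - 1) * (1 + Real.log l) ^ ((p - 1) / 2)) := by
    refine setLIntegral_congr_fun measurableSet_Ioo fun l hl ↦ ?_
    have h1 := hw0 l hl
    have h2 := hW l hl
    have h3 : 0 < l := by linarith [hl.1]
    rw [ENNReal.mul_rpow_of_nonneg _ _ hp0.le, ENNReal.ofReal_rpow_of_pos (by positivity),
      ← Real.rpow_mul h1.le, hw, Real.mul_rpow h3.le (by positivity), ← Real.rpow_mul h2.le]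
    congr 4 <;> simp only [hq] <;> field_simp
  have e3 : ∫⁻ l in Ioo 1 h, (ENNReal.ofReal (w l ^ (-(1 / q)))) ^ q ≤
      ENNReal.ofReal (2 * (1 + Real.log h) ^ (1 / 2 : ℝ)) := by
    refine le_trans (le_of_eq ?_) (lintegral_inv_mul_log_rpow_neg_half_le hh)
    refine setLIntegral_congr_fun measurableSet_Ioo fun l hl ↦ ?_
    have h1 := hw0 l hl
    have h2 := hW l hl
    have h3 : 0 < l := by linarith [hl.1]
    rw [ENNReal.ofReal_rpow_of_pos (by positivity), ← Real.rpow_mul h1.le,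
      show -(1 / q) * q = -1 by field_simp, hw, Real.mul_rpow h3.le (by positivity),
      ← Real.rpow_mul h2.le, Real.rpow_neg_one]
    norm_num
  rw [e1]
  calc _ ≤ _ := ENNReal.rpow_le_rpow key hp0.le
    _ ≤ _ := by
      rw [ENNReal.mul_rpow_of_nonneg _ _ hp0.le, ← ENNReal.rpow_mul, ← ENNReal.rpow_mul, e2,
        show 1 / p * p = 1 by field_simp, ENNReal.rpow_one,
        show 1 / q * p = p - 1 by rw [hq]; field_simp]
      gcongr

theorem exists_hardy_log {p b : ℝ} (hp : 1 < p) (hb : 0 < b) :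
    ∃ C : ℝ≥0, ∀ ψ : ℝ → ℝ≥0∞, Measurable ψ →
      ∫⁻ t in Ioo (0 : ℝ) 1, ENNReal.ofReal (t⁻¹ * Real.log (Real.exp 1 / t) ^ (-p)) *
        (∫⁻ l in Ioo 1 (t ^ (-b)), ψ l) ^ p ≤
      C * ∫⁻ l in Ioi 1, ψ l ^ p * ENNReal.ofReal (l ^ (p - 1)) := by
  set β := (p - 1) / 2 with hβ
  have hp1 : 0 < p - 1 := by linarith
  have hβ0 : 0 < β := by positivity
  set K : ℝ := (2 * (1 + b) ^ (1 / 2 : ℝ)) ^ (p - 1) with hK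
  have hK0 : 0 < K := by positivity
  refine ⟨(K * (β⁻¹ * (1 + b) ^ β)).toNNReal, fun ψ hψ ↦ ?_⟩
  set V : ℝ → ℝ≥0∞ := fun l ↦ ψ l ^ p *
        ENNReal.ofReal (l ^ (p - 1) * (1 + Real.log l) ^ β) with hV
  have hVm : Measurable V := by fun_prop
  set a : ℝ → ℝ := fun t ↦ t⁻¹ * Real.log (Real.exp 1 / t) ^ (-β - 1) with ha
  have ham : Measurable a := by fun_prop
  calc
    _ ≤ ∫⁻ t in Ioo (0 : ℝ) 1, ENNReal.ofReal K * (∫⁻ l in Ioi 1,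
          (Ioo 0 (l ^ (-b⁻¹))).indicator (fun t ↦ ENNReal.ofReal (a t)) t * V l) := by
        refine setLIntegral_mono' measurableSet_Ioo fun t ht ↦ ?_
        have ht0 := ht.1
        have hL := one_le_log_exp_one_div ht.1 ht.2.le
        have hL0 : 0 < Real.log (Real.exp 1 / t) := by linarith
        have hh : 1 ≤ t ^ (-b) := Real.one_le_rpow_of_pos_of_le_one_of_nonpos ht.1 ht.2.le (by linarith)
        have hlh : 0 ≤ Real.log (t ^ (-b)) := Real.log_nonneg hh
        have hWL : 1 + Real.log (t ^ (-b)) ≤ (1 + b) * Real.log (Real.exp 1 / t) := by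
          rw [log_exp_one_div ht0, Real.log_rpow ht0]
          nlinarith [Real.log_nonpos ht0.le ht.2.le]
        have eX : ∫⁻ l in Ioi 1, (Ioo 0 (l ^ (-b⁻¹))).indicator (fun t ↦ ENNReal.ofReal (a t)) t * V l
            = ENNReal.ofReal (a t) * ∫⁻ l in Ioo 1 (t ^ (-b)), V l := by
          rw [← lintegral_const_mul _ hVm, ← lintegral_indicator measurableSet_Ioi,
            ← lintegral_indicator measurableSet_Ioo]
          congr 1 with l
          by_cases hl : 1 < l
          · have hl0 : 0 < l := by linarith
            have hiff : t < l ^ (-b⁻¹) ↔ l < t ^ (-b) := by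
              rw [← inv_neg]
              exact Real.lt_rpow_inv_iff_of_neg ht0 hl0 (neg_neg_of_pos hb)
            by_cases hlt : l < t ^ (-b)
            · simp [indicator, hl, hlt, hiff.2 hlt, ht0]
            · simp [indicator, hl, hlt, hiff]
          · simp [indicator, hl]
        rw [eX]
        calc _ ≤ ENNReal.ofReal (t⁻¹ * Real.log (Real.exp 1 / t) ^ (-p)) *
              ((∫⁻ l in Ioo 1 (t ^ (-b)), V l) *
                ENNReal.ofReal (2 * (1 + Real.log (t ^ (-b))) ^ (1 / 2 : ℝ)) ^ (p - 1)) := by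
              gcongr
              exact lintegral_Ioo_one_rpow_le hp hh hψ
          _ ≤ ENNReal.ofReal (t⁻¹ * Real.log (Real.exp 1 / t) ^ (-p)) *
              ((∫⁻ l in Ioo 1 (t ^ (-b)), V l) *
                ENNReal.ofReal (2 * ((1 + b) * Real.log (Real.exp 1 / t)) ^ (1 / 2 : ℝ)) ^ (p - 1)) := by
              gcongr
          _ = _ := by
              have e : ENNReal.ofReal (t⁻¹ * Real.log (Real.exp 1 / t) ^ (-p)) *
                  ENNReal.ofReal (2 * ((1 + b) * Real.log (Real.exp 1 / t)) ^ (1 / 2 : ℝ)) ^ (p - 1)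
                  = ENNReal.ofReal K * ENNReal.ofReal (a t) := by
                rw [ENNReal.ofReal_rpow_of_pos (by positivity), ← ENNReal.ofReal_mul (by positivity),
                  ← ENNReal.ofReal_mul (by positivity), Real.mul_rpow (by positivity) hL0.le,
                  ← mul_assoc 2, Real.mul_rpow (by positivity) (by positivity), ← hK,
                  ← Real.rpow_mul hL0.le, ha]
                have : Real.log (Real.exp 1 / t) ^ (-β - 1) = Real.log (Real.exp 1 / t) ^ (-p) *
                    Real.log (Real.exp 1 / t) ^ (1 / 2 * (p - 1)) := by
                  rw [← Real.rpow_add hL0]; congr 1; rw [hβ]; ring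
                simp only [this]
                congr 1; ring
              rw [mul_left_comm, e]
              ring
    _ = ENNReal.ofReal K * ∫⁻ l in Ioi (1 : ℝ), ∫⁻ t in Ioo (0 : ℝ) 1,
          (Ioo 0 (l ^ (-b⁻¹))).indicator (fun t ↦ ENNReal.ofReal (a t)) t * V l := by
        rw [lintegral_const_mul' _ _ ENNReal.ofReal_ne_top, lintegral_lintegral_swap]
        refine Measurable.aemeasurable (Measurable.mul ?_ (hVm.comp measurable_snd))
        have : MeasurableSet {q : ℝ × ℝ | 0 < q.1 ∧ q.1 < q.2 ^ (-b⁻¹)} :=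
          (measurableSet_lt measurable_const measurable_fst).inter
            (measurableSet_lt measurable_fst (by fun_prop))
        exact Measurable.indicator (s := {q : ℝ × ℝ | 0 < q.1 ∧ q.1 < q.2 ^ (-b⁻¹)})
            (f := fun q : ℝ × ℝ ↦ ENNReal.ofReal (a q.1)) (by fun_prop) this
    _ ≤ ENNReal.ofReal K * ∫⁻ l in Ioi (1 : ℝ), ENNReal.ofReal (β⁻¹ * (1 + b) ^ β) *
          (ψ l ^ p * ENNReal.ofReal (l ^ (p - 1))) := by
        gcongr 1
        refine setLIntegral_mono' measurableSet_Ioi fun l hl ↦ ?_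
        have hl : 1 < l := hl
        have hl0 : 0 < l := by linarith
        have hll : 0 ≤ Real.log l := Real.log_nonneg hl.le
        rw [lintegral_mul_const _ (by measurability)]
        have hs0 : 0 < l ^ (-b⁻¹) := by positivity
        have hs1 : l ^ (-b⁻¹) ≤ 1 := Real.rpow_le_one_of_one_le_of_nonpos hl.le (by simp [hb.le])
        have hLW : (1 + b)⁻¹ * (1 + Real.log l) ≤ Real.log (Real.exp 1 / l ^ (-b⁻¹)) := by
          rw [log_exp_one_div hs0, Real.log_rpow hl0]
          field_simp
          nlinarith
        calc _ ≤ ENNReal.ofReal (β⁻¹ * Real.log (Real.exp 1 / l ^ (-b⁻¹)) ^ (-β)) * V l := by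
              gcongr
              refine (setLIntegral_le_lintegral _ _).trans ?_
              rw [lintegral_indicator measurableSet_Ioo]
              exact lintegral_inv_mul_log_rpow_le hβ0 hs0 hs1
          _ ≤ ENNReal.ofReal (β⁻¹ * ((1 + b)⁻¹ * (1 + Real.log l)) ^ (-β)) * V l := by
              gcongr ENNReal.ofReal (β⁻¹ * ?_) * _
              exact Real.rpow_le_rpow_of_nonpos (by positivity) hLW (by linarith)
          _ = _ := by
              simp only [hV]
              rw [mul_left_comm, mul_left_comm _ (ψ l ^ p), ← ENNReal.ofReal_mul (by positivity),
                ← ENNReal.ofReal_mul (by positivity)]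
              congr 2
              rw [Real.mul_rpow (by positivity) (by positivity), Real.inv_rpow (by positivity),
                Real.rpow_neg (by positivity), Real.rpow_neg (by positivity)]
              field_simp
    _ = _ := by
        rw [lintegral_const_mul' _ _ ENNReal.ofReal_ne_top, ← mul_assoc,
          ← ENNReal.ofReal_mul hK0.le]
        rfl

theorem exists_lintegral_riesz_low_le {E : Type*} [NormedAddCommGroup E]
    [MeasurableSpace E] [BorelSpace E] (ν : Measure E) [IsFiniteMeasure ν] {A D γ : ℝ}
    (hA : 0 ≤ A) (hγ : 0 < γ) (hγD : γ < D)
    (hν : ∀ (x : E) (r : ℝ), 0 < r → ν (Metric.ball x r) ≤ ENNReal.ofReal (A * r ^ D)) :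
    ∃ C : ℝ≥0, ∀ (f : E → ℝ), Measurable f → 0 ≤ f → ∀ (x : E) (h : ℝ),
      ∫⁻ y in {y | f y ≤ h}, ENNReal.ofReal (f y) * ENNReal.ofReal (‖x - y‖ ^ (-γ)) ∂ν ≤
        C * ∫⁻ l in Ioo 0 h, ν {y | l < f y} ^ (1 - γ / D) := by
  obtain ⟨C, hC⟩ := exists_setLIntegral_rpow_norm_sub_le ν hA hγ hγD hν
  refine ⟨C, fun f hf hf0 x h ↦ ?_⟩
  have hk : Measurable fun y ↦ ENNReal.ofReal (‖x - y‖ ^ (-γ)) := by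
    have : Continuous fun y : E ↦ ‖x - y‖ := by fun_prop
    exact (this.measurable.pow_const _).ennreal_ofReal
  set κ := ν.withDensity fun y ↦ ENNReal.ofReal (‖x - y‖ ^ (-γ)) with hκ
  have hS : MeasurableSet {y | f y ≤ h} := measurableSet_le hf measurable_const
  calc _ = ∫⁻ y in {y | f y ≤ h}, ENNReal.ofReal (f y) ∂κ := by
        rw [hκ, setLIntegral_withDensity_eq_setLIntegral_mul _ hk hf.ennreal_ofReal hS]
        simp [mul_comm]
    _ = ∫⁻ l in Ioi 0, (κ.restrict {y | f y ≤ h}) {y | l < f y} :=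
        lintegral_eq_lintegral_meas_lt _ (Filter.Eventually.of_forall hf0) hf.aemeasurable
    _ ≤ ∫⁻ l in Ioi 0, (Ioo 0 h).indicator (fun l ↦ C * ν {y | l < f y} ^ (1 - γ / D)) l := by
        refine setLIntegral_mono' measurableSet_Ioi fun l hl ↦ ?_
        have hl : 0 < l := hl
        have hSl : MeasurableSet {y | l < f y} := measurableSet_lt measurable_const hf
        by_cases hlh : l < h
        · rw [indicator_of_mem (show l ∈ Ioo 0 h from ⟨hl, hlh⟩)]
          refine (Measure.restrict_apply_le _ _).trans ?_
          rw [hκ, withDensity_apply _ hSl]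
          exact hC x _ (measure_ne_top _ _)
        · rw [Measure.restrict_apply hSl]
          have : {y | l < f y} ∩ {y | f y ≤ h} = ∅ := by
            ext y
            simp only [mem_inter_iff, mem_ofPred_eq, mem_empty_iff_false, iff_false, not_and]
            intros
            linarith
          simp [this]
    _ ≤ _ := by
        refine (setLIntegral_le_lintegral _ _).trans ?_
        rw [lintegral_indicator measurableSet_Ioo, lintegral_const_mul' _ _ ENNReal.coe_ne_top]

theorem exists_lintegral_rpow_riesz_le {E : Type*} [NormedAddCommGroup E]
    [MeasurableSpace E] [BorelSpace E] [SecondCountableTopology E] (ν μ : Measure E)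
    [IsFiniteMeasure ν] [IsFiniteMeasure μ] {A B D d p : ℝ} (hA : 0 ≤ A) (hB : 0 ≤ B)
    (hd : 0 < d) (hdD : d ≤ D) (hp : 1 < p)
    (hν : ∀ (x : E) (r : ℝ), 0 < r → ν (Metric.ball x r) ≤ ENNReal.ofReal (A * r ^ D))
    (hμ : ∀ (x : E) (r : ℝ), 0 < r → μ (Metric.ball x r) ≤ ENNReal.ofReal (B * r ^ d)) :
    ∃ C : ℝ≥0, ∀ (f : E → ℝ), Measurable f → 0 ≤ f → ∀ S : Set E,
      ∫⁻ x, (∫⁻ y in S, ENNReal.ofReal (f y) *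
        ENNReal.ofReal (‖x - y‖ ^ (-(D * (p - 1) / p))) ∂ν) ^ p ∂μ ≤
        C * ν S ^ (d / p / D * (p - 1)) * ∫⁻ y, ENNReal.ofReal (f y ^ p) ∂ν := by
  have hp0 : 0 < p := by linarith
  have hp1 : 0 < p - 1 := by linarith
  have hD : 0 < D := hd.trans_le hdD
  set q := p / (p - 1) with hq
  have hpq : p.HolderConjugate q := Real.HolderConjugate.conjExponent hp
  have hq0 : 0 < q := hpq.symm.pos
  have hdpD : d / p < D := (div_lt_self hd hp).trans_le hdD
  set δ := d * (p - 1) / p with hδ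
  have hδ0 : 0 < δ := by positivity
  have hδd : δ < d := by rw [hδ, div_lt_iff₀ hp0]; nlinarith
  obtain ⟨C₁, hC₁⟩ := exists_setLIntegral_rpow_norm_sub_le ν hA (γ := D - d / p) (by linarith)
    (by linarith [div_pos hd hp0]) hν
  obtain ⟨C₂, hC₂⟩ := exists_setLIntegral_rpow_norm_sub_le μ hB hδ0 hδd hμ
  have hMt : μ univ ^ (1 - δ / d) ≠ ⊤ :=
    ENNReal.rpow_ne_top_of_nonneg (by rw [sub_nonneg, div_le_one hd]; exact hδd.le)
      (measure_ne_top _ _)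
  refine ⟨C₁ ^ (p - 1) * (C₂ * (μ univ ^ (1 - δ / d)).toNNReal), fun f hf hf0 S ↦ ?_⟩
  have hk : Measurable fun z : E × E ↦ ‖z.1 - z.2‖ := by
    have : Continuous fun z : E × E ↦ ‖z.1 - z.2‖ := by fun_prop
    exact this.measurable
  have hkx : ∀ x : E, Measurable fun y ↦ ‖x - y‖ := fun x ↦ hk.comp measurable_prodMk_left
  have holder : ∀ x, (∫⁻ y in S, ENNReal.ofReal (f y) *
        ENNReal.ofReal (‖x - y‖ ^ (-(D * (p - 1) / p))) ∂ν) ^ p ≤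
      (∫⁻ y, ENNReal.ofReal (f y ^ p) * ENNReal.ofReal (‖x - y‖ ^ (-δ)) ∂ν) *
        (C₁ * ν S ^ (d / p / D)) ^ (p - 1) := by
    intro x
    have hx := hkx x
    have key := ENNReal.lintegral_mul_le_Lp_mul_Lq (ν.restrict S) hpq
      (f := fun y ↦ ENNReal.ofReal (f y) * ENNReal.ofReal (‖x - y‖ ^ (-(δ / p))))
      (g := fun y ↦ ENNReal.ofReal (‖x - y‖ ^ (-((D - d / p) / q)))) (by fun_prop) (by fun_prop)
    have e1 : ∀ y, ((fun y ↦ ENNReal.ofReal (f y) * ENNReal.ofReal (‖x - y‖ ^ (-(δ / p)))) *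
        fun y ↦ ENNReal.ofReal (‖x - y‖ ^ (-((D - d / p) / q)))) y =
        ENNReal.ofReal (f y) * ENNReal.ofReal (‖x - y‖ ^ (-(D * (p - 1) / p))) := by
      intro y
      have he : -(D * (p - 1) / p) = -(δ / p) + -((D - d / p) / q) := by
        rw [hδ, hq]; field_simp; ring
      have hne : -(δ / p) + -((D - d / p) / q) ≠ 0 := by
        rw [← he]
        have : 0 < D * (p - 1) / p := by positivity
        linarith
      simp only [Pi.mul_apply]
      rw [mul_assoc, ← ENNReal.ofReal_mul (by positivity), he,
        Real.rpow_add' (norm_nonneg _) hne]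
    have e2 : ∀ y, (ENNReal.ofReal (f y) * ENNReal.ofReal (‖x - y‖ ^ (-(δ / p)))) ^ p =
        ENNReal.ofReal (f y ^ p) * ENNReal.ofReal (‖x - y‖ ^ (-δ)) := by
      intro y
      rw [ENNReal.mul_rpow_of_nonneg _ _ hp0.le, ENNReal.ofReal_rpow_of_nonneg (hf0 y) hp0.le,
        ENNReal.ofReal_rpow_of_nonneg (by positivity) hp0.le, ← Real.rpow_mul (norm_nonneg _)]
      congr 3; field_simp
    have e3 : ∀ y, ENNReal.ofReal (‖x - y‖ ^ (-((D - d / p) / q))) ^ q =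
        ENNReal.ofReal (‖x - y‖ ^ (-(D - d / p))) := by
      intro y
      rw [ENNReal.ofReal_rpow_of_nonneg (by positivity) hq0.le, ← Real.rpow_mul (norm_nonneg _)]
      congr 2; field_simp
    simp only [e1, e2, e3] at key
    calc _ ≤ _ := ENNReal.rpow_le_rpow key hp0.le
      _ ≤ _ := by
        rw [ENNReal.mul_rpow_of_nonneg _ _ hp0.le, ← ENNReal.rpow_mul, ← ENNReal.rpow_mul,
          show 1 / p * p = 1 by field_simp, ENNReal.rpow_one,
          show 1 / q * p = p - 1 by rw [hq]; field_simp]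
        gcongr
        · exact Measure.restrict_le_self
        · refine (hC₁ x S (measure_ne_top _ _)).trans (le_of_eq ?_)
          congr 2; field_simp; ring
  calc _ ≤ ∫⁻ x, (∫⁻ y, ENNReal.ofReal (f y ^ p) * ENNReal.ofReal (‖x - y‖ ^ (-δ)) ∂ν) *
        (C₁ * ν S ^ (d / p / D)) ^ (p - 1) ∂μ := lintegral_mono holder
    _ = (∫⁻ x, ∫⁻ y, ENNReal.ofReal (f y ^ p) * ENNReal.ofReal (‖x - y‖ ^ (-δ)) ∂ν ∂μ) *
        (C₁ * ν S ^ (d / p / D)) ^ (p - 1) := by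
      refine lintegral_mul_const' _ _ (ENNReal.rpow_ne_top_of_nonneg hp1.le
        (ENNReal.mul_ne_top ENNReal.coe_ne_top
          (ENNReal.rpow_ne_top_of_nonneg (by positivity) (measure_ne_top _ _))))
    _ = (∫⁻ y, ∫⁻ x, ENNReal.ofReal (f y ^ p) * ENNReal.ofReal (‖x - y‖ ^ (-δ)) ∂μ ∂ν) *
        (C₁ * ν S ^ (d / p / D)) ^ (p - 1) := by
      rw [lintegral_lintegral_swap (Measurable.aemeasurable ?_)]
      exact (((hf.comp measurable_snd).pow_const _).ennreal_ofReal).mul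
        (hk.pow_const _).ennreal_ofReal
    _ ≤ (∫⁻ y, ENNReal.ofReal (f y ^ p) * (C₂ * μ univ ^ (1 - δ / d)) ∂ν) *
        (C₁ * ν S ^ (d / p / D)) ^ (p - 1) := by
      gcongr with y
      rw [lintegral_const_mul' _ _ ENNReal.ofReal_ne_top]
      gcongr
      have := hC₂ y univ (measure_ne_top _ _)
      simp only [Measure.restrict_univ, norm_sub_rev y] at this
      exact this
    _ = _ := by
      rw [lintegral_mul_const' _ _ (ENNReal.mul_ne_top ENNReal.coe_ne_top hMt),
        ENNReal.mul_rpow_of_nonneg _ _ hp1.le, ← ENNReal.rpow_mul, ENNReal.coe_mul, ENNReal.coe_mul,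
        ENNReal.coe_toNNReal hMt, ENNReal.coe_rpow_of_nonneg _ hp1.le]
      ring

theorem rearr_le {α : Type*} [MeasurableSpace α] {ν : Measure α} {u : α → ℝ} {s : ℝ} {ρ : ℝ≥0∞}
    (h : ν {x | ρ < ENNReal.ofReal |u x|} ≤ ENNReal.ofReal s) : rearr ν u s ≤ ρ :=
  sInf_le h

theorem exists_rearr_le_lintegral_level {E : Type*} [NormedAddCommGroup E]
    [MeasurableSpace E] [BorelSpace E] [SecondCountableTopology E] (ν μ : Measure E)
    [IsFiniteMeasure ν] [IsFiniteMeasure μ] (hμ0 : μ ≠ 0) {A B D d p : ℝ} (hA : 0 ≤ A)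
    (hB : 0 ≤ B) (hd : 0 < d) (hdD : d ≤ D) (hp : 1 < p)
    (hν : ∀ (x : E) (r : ℝ), 0 < r → ν (Metric.ball x r) ≤ ENNReal.ofReal (A * r ^ D))
    (hμ : ∀ (x : E) (r : ℝ), 0 < r → μ (Metric.ball x r) ≤ ENNReal.ofReal (B * r ^ d)) :
    ∃ b : ℝ, 0 < b ∧ ∃ C : ℝ≥0, ∀ (f : E → ℝ), Measurable f → 0 ≤ f →
      ∫⁻ y, ENNReal.ofReal (f y ^ p) ∂ν ≤ 1 → ∀ (N : ℝ≥0∞) (v : E → ℝ),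
      (∀ x, ENNReal.ofReal |v x| ≤ N * ∫⁻ y, ENNReal.ofReal (f y) *
        ENNReal.ofReal (‖x - y‖ ^ (-(D * (p - 1) / p))) ∂ν) →
      ∀ t ∈ Ioo (0 : ℝ) 1, rearr μ v ((μ univ).toReal * t) ≤
        N * (C * (1 + ∫⁻ l in Ioo 0 (t ^ (-b)), ν {y | l < f y} ^ (1 / p))) := by
  have hp0 : 0 < p := by linarith
  have hp1 : 0 < p - 1 := by linarith
  have hD : 0 < D := hd.trans_le hdD
  obtain ⟨C₁, hC₁⟩ := exists_lintegral_riesz_low_le ν hA (γ := D * (p - 1) / p) (by positivity)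
    (by rw [div_lt_iff₀ hp0]; nlinarith) hν
  obtain ⟨C₂, hC₂⟩ := exists_lintegral_rpow_riesz_le ν μ hA hB hd hdD hp hν hμ
  have hexp : 1 - D * (p - 1) / p / D = 1 / p := by field_simp; ring
  rw [hexp] at hC₁
  set M := (μ univ).toReal with hM
  have hM0 : 0 < M := ENNReal.toReal_pos (by simpa using hμ0) (measure_ne_top _ _)
  set κ := d / p / D * (p - 1) with hκ
  have hκ0 : 0 < κ := by positivity
  set K : ℝ := ((C₂ + 1) / M) ^ (1 / p) with hK
  have hK0 : 0 < K := by positivity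
  have hKp : K ^ p = (C₂ + 1) / M := by
    rw [hK, ← Real.rpow_mul (by positivity)]; simp [hp0.ne']
  refine ⟨1 / (p * κ), by positivity, C₁ + K.toNNReal, fun f hf hf0 hf1 N v hv t ht ↦ ?_⟩
  have ht0 := ht.1
  set h := t ^ (-(1 / (p * κ))) with hh
  have hh0 : 0 < h := by positivity
  set R : E → ℝ≥0∞ := fun x ↦ ∫⁻ y in {y | h < f y}, ENNReal.ofReal (f y) *
    ENNReal.ofReal (‖x - y‖ ^ (-(D * (p - 1) / p))) ∂ν with hR
  have hS : MeasurableSet {y | f y ≤ h} := measurableSet_le hf measurable_const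
  have hSc : {y | f y ≤ h}ᶜ = {y | h < f y} := by ext; simp
  have hRm : Measurable R := by
    have hk : Measurable fun z : E × E ↦ ‖z.1 - z.2‖ := by
      have : Continuous fun z : E × E ↦ ‖z.1 - z.2‖ := by fun_prop
      exact this.measurable
    exact Measurable.lintegral_prod_right' (f := fun z : E × E ↦ ENNReal.ofReal (f z.2) *
      ENNReal.ofReal (‖z.1 - z.2‖ ^ (-(D * (p - 1) / p))))
      ((hf.comp measurable_snd).ennreal_ofReal.mul (hk.pow_const _).ennreal_ofReal)
  set Λ := ∫⁻ l in Ioo 0 h, ν {y | l < f y} ^ (1 / p) with hΛ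
  have hsplit : ∀ x, ENNReal.ofReal |v x| ≤ N * (C₁ * Λ + R x) := by
    intro x
    refine (hv x).trans ?_
    rw [← lintegral_add_compl _ hS, hSc]
    gcongr
    exact hC₁ f hf hf0 x h
  refine (rearr_le (ρ := N * (C₁ * Λ + ENNReal.ofReal K)) ?_).trans ?_
  · have hlevel : ν {y | h < f y} ≤ ENNReal.ofReal (h ^ (-p)) := by
      have hmk := mul_meas_ge_le_lintegral₀ (μ := ν) (f := fun y ↦ ENNReal.ofReal (f y ^ p))
        (hf.pow_const p).ennreal_ofReal.aemeasurable (ENNReal.ofReal (h ^ p))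
      have hsub : ν {y | h < f y} ≤ ν {y | ENNReal.ofReal (h ^ p) ≤ ENNReal.ofReal (f y ^ p)} := by
        refine measure_mono fun y hy ↦ ENNReal.ofReal_le_ofReal ?_
        exact Real.rpow_le_rpow hh0.le (le_of_lt hy) hp0.le
      rw [Real.rpow_neg hh0.le, ENNReal.ofReal_inv_of_pos (by positivity)]
      rw [ENNReal.le_inv_iff_mul_le, mul_comm]
      exact ((mul_le_mul_right hsub _).trans hmk).trans hf1
    have hint : ∫⁻ x, R x ^ p ∂μ ≤ ENNReal.ofReal (C₂ * t) := by
      refine (hC₂ f hf hf0 _).trans ?_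
      calc _ ≤ C₂ * ENNReal.ofReal (h ^ (-p)) ^ κ * 1 := by gcongr
        _ = _ := by
          rw [mul_one, ENNReal.ofReal_rpow_of_pos (by positivity), ← Real.rpow_mul hh0.le, hh,
            ← Real.rpow_mul ht0.le, ENNReal.ofReal_mul (by positivity), ENNReal.ofReal_coe_nnreal]
          congr 2
          rw [show -(1 / (p * κ)) * (-p * κ) = 1 by field_simp, Real.rpow_one]
    have hmk := mul_meas_ge_le_lintegral₀ (μ := μ) (f := fun x ↦ R x ^ p)
        (hRm.pow_const p).aemeasurable (ENNReal.ofReal (K ^ p))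
    have hsub : μ {x | N * (C₁ * Λ + ENNReal.ofReal K) < ENNReal.ofReal |v x|} ≤
        μ {x | ENNReal.ofReal (K ^ p) ≤ R x ^ p} := by
      refine measure_mono fun x hx ↦ ?_
      have h1 : N * (C₁ * Λ + ENNReal.ofReal K) < N * (C₁ * Λ + R x) :=
        lt_of_lt_of_le hx (hsplit x)
      have h2 := lt_of_mul_lt_mul_left' h1
      have h3 : ENNReal.ofReal K < R x := lt_of_add_lt_add_left h2
      change ENNReal.ofReal (K ^ p) ≤ R x ^ p
      rw [← ENNReal.ofReal_rpow_of_pos hK0]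
      gcongr
    have hfin : ENNReal.ofReal (K ^ p) * μ {x | N * (C₁ * Λ + ENNReal.ofReal K) <
        ENNReal.ofReal |v x|} ≤ ENNReal.ofReal (K ^ p) * ENNReal.ofReal (M * t) := by
      refine ((mul_le_mul_right hsub _).trans hmk).trans (hint.trans ?_)
      rw [← ENNReal.ofReal_mul (by positivity), hKp]
      apply ENNReal.ofReal_le_ofReal
      field_simp
      linarith
    exact (ENNReal.mul_le_mul_iff_right (by simpa using (by positivity : 0 < K ^ p))
      ENNReal.ofReal_ne_top).1 hfin
  · gcongr
    rw [mul_add, mul_one, ENNReal.coe_add, add_mul]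
    have : ENNReal.ofReal K = (K.toNNReal : ℝ≥0∞) := rfl
    rw [this]
    calc _ ≤ (C₁ : ℝ≥0∞) * Λ + K.toNNReal + (C₁ + K.toNNReal * Λ) := le_self_add
      _ = _ := by ring

theorem exists_lintegral_rearr_rpow_le {E : Type*} [NormedAddCommGroup E]
    [MeasurableSpace E] [BorelSpace E] [SecondCountableTopology E] (ν μ : Measure E)
    [IsFiniteMeasure ν] [IsFiniteMeasure μ] {A B D d p : ℝ} (hA : 0 ≤ A)
    (hB : 0 ≤ B) (hd : 0 < d) (hdD : d ≤ D) (hp : 1 < p)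
    (hν : ∀ (x : E) (r : ℝ), 0 < r → ν (Metric.ball x r) ≤ ENNReal.ofReal (A * r ^ D))
    (hμ : ∀ (x : E) (r : ℝ), 0 < r → μ (Metric.ball x r) ≤ ENNReal.ofReal (B * r ^ d)) :
    ∃ C : ℝ≥0, ∀ (f : E → ℝ), Measurable f → 0 ≤ f →
      ∫⁻ y, ENNReal.ofReal (f y ^ p) ∂ν ≤ 1 → ∀ (N : ℝ≥0∞) (v : E → ℝ),
      (∀ x, ENNReal.ofReal |v x| ≤ N * ∫⁻ y, ENNReal.ofReal (f y) *
        ENNReal.ofReal (‖x - y‖ ^ (-(D * (p - 1) / p))) ∂ν) →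
      ∫⁻ t in Ioo (0 : ℝ) 1, (ENNReal.ofReal (t ^ (-(1 / p)) * (Real.log (Real.exp 1 / t))⁻¹) *
        rearr μ v ((μ univ).toReal * t)) ^ p ≤ C * N ^ p := by
  have hp0 : 0 < p := by linarith
  have hp1 : 0 < p - 1 := by linarith
  rcases eq_or_ne μ 0 with rfl | hμ0
  · refine ⟨0, fun f _ _ _ N v _ ↦ ?_⟩
    have : ∀ s, rearr (0 : Measure E) v s = 0 := fun s ↦
      le_antisymm (rearr_le (by simp)) bot_le
    simp [this, hp0]
  obtain ⟨b, hb, C₁, hC₁⟩ := exists_rearr_le_lintegral_level ν μ hμ0 hA hB hd hdD hp hν hμ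
  obtain ⟨C₂, hC₂⟩ := exists_hardy_log hp hb
  have hat : ν univ ^ (1 / p) ≠ ⊤ :=
    ENNReal.rpow_ne_top_of_nonneg (by positivity) (measure_ne_top _ _)
  set a := 1 + ν univ ^ (1 / p) with ha
  have hat' : a ≠ ⊤ := by finiteness
  set T : ℝ≥0∞ := C₁ ^ p * 2 ^ (p - 1) * (a ^ p * ENNReal.ofReal ((p - 1)⁻¹) + C₂) with hT
  have hTt : T ≠ ⊤ := by
    have h1 : a ^ p ≠ ⊤ := ENNReal.rpow_ne_top_of_nonneg hp0.le hat'
    have h2 : (C₁ : ℝ≥0∞) ^ p ≠ ⊤ := ENNReal.rpow_ne_top_of_nonneg hp0.le ENNReal.coe_ne_top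
    have h3 : (2 : ℝ≥0∞) ^ (p - 1) ≠ ⊤ := ENNReal.rpow_ne_top_of_nonneg hp1.le (by simp)
    finiteness
  refine ⟨T.toNNReal, fun f hf hf0 hf1 N v hv ↦ ?_⟩
  rw [ENNReal.coe_toNNReal hTt]
  set ψ : ℝ → ℝ≥0∞ := fun l ↦ ν {y | l < f y} ^ (1 / p) with hψ
  have hψm : Measurable ψ := by
    have : Antitone fun l ↦ ν {y | l < f y} := fun l l' hl ↦
      measure_mono fun y hy ↦ lt_of_le_of_lt hl hy
    exact this.measurable.pow_const _
  have hψp : ∫⁻ l in Ioi 1, ψ l ^ p * ENNReal.ofReal (l ^ (p - 1)) ≤ 1 := by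
    have h1 := lintegral_rpow_eq_lintegral_meas_lt_mul ν (Filter.Eventually.of_forall hf0)
      hf.aemeasurable hp0
    rw [h1] at hf1
    refine le_trans ?_ hf1
    calc _ ≤ 1 * ∫⁻ l in Ioi 0, ν {y | l < f y} * ENNReal.ofReal (l ^ (p - 1)) := by
          rw [one_mul]
          refine (lintegral_mono_set (Ioi_subset_Ioi zero_le_one)).trans (le_of_eq ?_)
          simp [hψ, ← ENNReal.rpow_mul, hp0.ne']
      _ ≤ _ := by
          gcongr
          simpa using hp.le
  set W : ℝ → ℝ≥0∞ := fun t ↦ ENNReal.ofReal (t⁻¹ * Real.log (Real.exp 1 / t) ^ (-p)) with hW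
  have hWm : Measurable W := by fun_prop
  have hW1 : ∫⁻ t in Ioo 0 1, W t ≤ ENNReal.ofReal ((p - 1)⁻¹) := by
    have := lintegral_inv_mul_log_rpow_le hp1 one_pos le_rfl
    simpa [hW] using this
  have hbound : ∀ t ∈ Ioo (0 : ℝ) 1,
      rearr μ v ((μ univ).toReal * t) ≤ N * (C₁ * (a + ∫⁻ l in Ioo 1 (t ^ (-b)), ψ l)) := by
    intro t ht
    refine (hC₁ f hf hf0 hf1 N v hv t ht).trans ?_
    rw [ha, add_assoc]
    gcongr
    calc ∫⁻ l in Ioo 0 (t ^ (-b)), ψ l ≤ ∫⁻ l in Ioc 0 1 ∪ Ioo 1 (t ^ (-b)), ψ l := by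
          refine lintegral_mono_set fun l hl ↦ ?_
          rcases le_or_gt l 1 with h | h
          · exact .inl ⟨hl.1, h⟩
          · exact .inr ⟨h, hl.2⟩
      _ ≤ (∫⁻ l in Ioc 0 1, ψ l) + ∫⁻ l in Ioo 1 (t ^ (-b)), ψ l := lintegral_union_le _ _ _
      _ ≤ _ := by
          gcongr
          calc _ ≤ ∫⁻ l in Ioc (0 : ℝ) 1, ν univ ^ (1 / p) := by
                refine lintegral_mono fun l ↦ ?_
                simp only [hψ]
                gcongr
                exact subset_univ _
            _ = _ := by simp
  calc _ ≤ ∫⁻ t in Ioo (0 : ℝ) 1, N ^ p * (C₁ ^ p * 2 ^ (p - 1)) *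
        (a ^ p * W t + W t * (∫⁻ l in Ioo 1 (t ^ (-b)), ψ l) ^ p) := by
        refine setLIntegral_mono' measurableSet_Ioo fun t ht ↦ ?_
        have ht0 := ht.1
        have hL := one_le_log_exp_one_div ht.1 ht.2.le
        have hL0 : 0 < Real.log (Real.exp 1 / t) := by linarith
        have hWe : ENNReal.ofReal (t ^ (-(1 / p)) * (Real.log (Real.exp 1 / t))⁻¹) ^ p = W t := by
          rw [ENNReal.ofReal_rpow_of_pos (by positivity), Real.mul_rpow (by positivity)
            (by positivity), ← Real.rpow_mul ht0.le, Real.inv_rpow hL0.le, ← Real.rpow_neg hL0.le,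
            show -(1 / p) * p = -1 by field_simp, Real.rpow_neg_one]
        rw [ENNReal.mul_rpow_of_nonneg _ _ hp0.le, hWe]
        calc _ ≤ W t * (N * (C₁ * (a + ∫⁻ l in Ioo 1 (t ^ (-b)), ψ l))) ^ p := by
              gcongr
              exact hbound t ht
          _ ≤ W t * (N ^ p * (C₁ ^ p * (2 ^ (p - 1) *
                (a ^ p + (∫⁻ l in Ioo 1 (t ^ (-b)), ψ l) ^ p)))) := by
              rw [ENNReal.mul_rpow_of_nonneg _ _ hp0.le, ENNReal.mul_rpow_of_nonneg _ _ hp0.le]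
              gcongr
              exact ENNReal.rpow_add_le_mul_rpow_add_rpow _ _ hp.le
          _ = _ := by ring
    _ ≤ N ^ p * (C₁ ^ p * 2 ^ (p - 1)) * (a ^ p * ENNReal.ofReal ((p - 1)⁻¹) + C₂ * 1) := by
        have hIm : Measurable fun t : ℝ ↦ W t * (∫⁻ l in Ioo 1 (t ^ (-b)), ψ l) ^ p := by
          refine hWm.mul (Measurable.pow_const ?_ _)
          have : Monotone fun s : ℝ ↦ ∫⁻ l in Ioo 1 s, ψ l := fun s s' hs ↦
            lintegral_mono_set (Ioo_subset_Ioo_right hs)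
          exact this.measurable.comp (measurable_id.pow_const _)
        have hsum : Measurable fun t : ℝ ↦
            a ^ p * W t + W t * (∫⁻ l in Ioo 1 (t ^ (-b)), ψ l) ^ p :=
          (hWm.const_mul _).add hIm
        rw [lintegral_const_mul _ hsum, lintegral_add_right _ hIm, lintegral_const_mul _ hWm]
        gcongr
        refine (hC₂ ψ hψm).trans ?_
        gcongr
    _ = _ := by rw [hT]; ring

/-- **Brézis–Wainger type inequality for `d`-Frostman measures in the limiting case
`p = n/m`:** `‖u‖_{L^{∞,n/m;-1}(Ω,μ)} ≤ C ‖∇^m u‖_{L^{n/m}(Ω)}`. -/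
theorem brezis_wainger_frostman (n m : ℕ) (hn : 2 ≤ n) (hm : 1 ≤ m) (hmn : m < n)
    (d : ℝ) (hd0 : 0 < d) (hdn : d ≤ n)
    (Ω : Set (EuclideanSpace ℝ (Fin n))) (hΩ : IsOpen Ω) (hΩvol : volume Ω < ⊤)
    (μ : Measure (EuclideanSpace ℝ (Fin n))) (hfin : IsFiniteMeasure μ) (hsupp : μ Ωᶜ = 0)
    (hFrostman : ∃ A : ℝ, ∀ (x : EuclideanSpace ℝ (Fin n)) (r : ℝ), 0 < r →
        μ (Metric.ball x r ∩ Ω) ≤ ENNReal.ofReal (A * r ^ d)) :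
    ∃ C : ℝ, 0 < C ∧
      ∀ u : EuclideanSpace ℝ (Fin n) → ℝ, ContDiff ℝ (⊤ : ℕ∞) u → HasCompactSupport u →
        tsupport u ⊆ Ω →
        (∫⁻ t in Set.Ioo (0 : ℝ) 1,
            (ENNReal.ofReal (t ^ (-(m : ℝ) / n) * (Real.log (Real.exp 1 / t))⁻¹) *
              rearr μ u ((μ Ω).toReal * t)) ^ ((n : ℝ) / m)) ^ ((m : ℝ) / n) ≤
          ENNReal.ofReal C *
            (∫⁻ x in Ω, ENNReal.ofReal (‖iteratedFDeriv ℝ m u x‖ ^ ((n : ℝ) / m))) ^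
              ((m : ℝ) / n) := by
  have hn0 : (0 : ℝ) < n := by exact_mod_cast (by omega : 0 < n)
  have hm0 : (0 : ℝ) < m := by exact_mod_cast hm
  have hmn' : (m : ℝ) < n := by exact_mod_cast hmn
  have hrank : Module.finrank ℝ (EuclideanSpace ℝ (Fin n)) = n := finrank_euclideanSpace_fin
  have : Nontrivial (EuclideanSpace ℝ (Fin n)) :=
    Module.nontrivial_of_finrank_pos (R := ℝ) (by omega)
  have hp : 1 < (n : ℝ) / m := by rwa [one_lt_div hm0]
  have hp0 : 0 < (n : ℝ) / m := by positivity
  have hmn0 : 0 < (m : ℝ) / n := by positivity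
  have hmul : (n : ℝ) / m * (m / n) = 1 := by field_simp
  have hν_fin : IsFiniteMeasure (volume.restrict Ω) := ⟨by simpa using hΩvol⟩
  have hν_ball : ∀ (x : EuclideanSpace ℝ (Fin n)) (r : ℝ), 0 < r →
      volume.restrict Ω (Metric.ball x r) ≤ ENNReal.ofReal
        ((volume (Metric.ball (0 : EuclideanSpace ℝ (Fin n)) 1)).toReal * r ^ (n : ℝ)) := by
    intro x r hr
    refine (Measure.restrict_apply_le _ _).trans ?_
    rw [Measure.addHaar_ball _ _ hr.le, hrank, mul_comm, ENNReal.ofReal_mul ENNReal.toReal_nonneg,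
      ENNReal.ofReal_toReal measure_ball_lt_top.ne, Real.rpow_natCast]
  obtain ⟨B, hB⟩ := hFrostman
  have hμ_ball : ∀ (x : EuclideanSpace ℝ (Fin n)) (r : ℝ), 0 < r →
      μ (Metric.ball x r) ≤ ENNReal.ofReal (max B 0 * r ^ d) := by
    intro x r hr
    rw [← measure_inter_add_sdiff _ hΩ.measurableSet,
      measure_mono_null (fun y hy ↦ hy.2 : Metric.ball x r \ Ω ⊆ Ωᶜ) hsupp, add_zero]
    refine (hB x r hr).trans ?_
    gcongr
    exact le_max_left _ _
  have hμ_univ : μ univ = μ Ω := by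
    rw [← measure_add_measure_compl hΩ.measurableSet, hsupp, add_zero]
  obtain ⟨C₁, hC₁⟩ := exists_lintegral_rearr_rpow_le (volume.restrict Ω) μ
    ENNReal.toReal_nonneg (le_max_right B 0) hd0 hdn hp hν_ball hμ_ball
  obtain ⟨C₀, hC₀⟩ := exists_abs_le_lintegral_riesz_iteratedFDeriv
    (volume : Measure (EuclideanSpace ℝ (Fin n))) hm (by omega)
  rw [hμ_univ] at hC₁
  rw [hrank] at hC₀
  have hexp : -((n : ℝ) * (n / m - 1) / (n / m)) = m - n := by field_simp; ring
  have hexp' : -(1 / ((n : ℝ) / m)) = -(m : ℝ) / n := by field_simp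
  rw [hexp, hexp'] at hC₁
  have hCt : (C₁ : ℝ≥0∞) ^ ((m : ℝ) / n) * C₀ ≠ ⊤ :=
    ENNReal.mul_ne_top (ENNReal.rpow_ne_top_of_nonneg hmn0.le ENNReal.coe_ne_top)
      ENNReal.coe_ne_top
  refine ⟨((C₁ : ℝ≥0∞) ^ ((m : ℝ) / n) * C₀).toReal + 1, by positivity, fun u hu huc hus ↦ ?_⟩
  set g : EuclideanSpace ℝ (Fin n) → ℝ := fun y ↦ ‖iteratedFDeriv ℝ m u y‖ with hg
  have hgc : Continuous g :=
    (hu.continuous_iteratedFDeriv (m := m) (by exact_mod_cast le_top)).norm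
  have hriesz : ∀ x, ENNReal.ofReal |u x| ≤ C₀ * ∫⁻ y in Ω, ENNReal.ofReal (g y) *
      ENNReal.ofReal (‖x - y‖ ^ ((m : ℝ) - n)) := by
    intro x
    refine (hC₀ u hu huc x).trans_eq ?_
    rw [setLIntegral_eq_of_support_subset]
    intro y hy
    refine hus (support_iteratedFDeriv_subset (𝕜 := ℝ) m fun h0 ↦ hy ?_)
    simp [hg, h0]
  set J := ∫⁻ x in Ω, ENNReal.ofReal (g x ^ ((n : ℝ) / m)) with hJ
  have hJJ : (J ^ ((m : ℝ) / n)) ^ ((n : ℝ) / m) = J := by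
    rw [← ENNReal.rpow_mul, mul_comm, hmul, ENNReal.rpow_one]
  rcases eq_or_ne J ⊤ with hJt | hJt
  · rw [hJt, ENNReal.top_rpow_of_pos hmn0, ENNReal.mul_top (by simp; positivity)]
    exact le_top
  suffices h : ∫⁻ t in Ioo (0 : ℝ) 1,
      (ENNReal.ofReal (t ^ (-(m : ℝ) / n) * (Real.log (Real.exp 1 / t))⁻¹) *
        rearr μ u ((μ Ω).toReal * t)) ^ ((n : ℝ) / m) ≤
      C₁ * (C₀ * J ^ ((m : ℝ) / n)) ^ ((n : ℝ) / m) by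
    calc _ ≤ (C₁ * (C₀ * J ^ ((m : ℝ) / n)) ^ ((n : ℝ) / m)) ^ ((m : ℝ) / n) := by gcongr
      _ = C₁ ^ ((m : ℝ) / n) * C₀ * J ^ ((m : ℝ) / n) := by
        rw [ENNReal.mul_rpow_of_nonneg _ _ hmn0.le, ← ENNReal.rpow_mul, hmul, ENNReal.rpow_one,
          mul_assoc]
      _ ≤ _ := by
        gcongr
        rw [← ENNReal.ofReal_toReal hCt]
        gcongr
        simp
  rcases eq_or_ne J 0 with hJ0 | hJ0
  · refine hC₁ (fun _ ↦ 0) measurable_const le_rfl (by simp [Real.zero_rpow hp0.ne']) _ u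
      fun x ↦ (hriesz x).trans ?_
    have hae := (lintegral_eq_zero_iff (by fun_prop)).1 (hJ.symm.trans hJ0)
    rw [lintegral_congr_ae (g := fun _ ↦ 0), lintegral_zero, mul_zero]
    · exact zero_le
    · filter_upwards [hae] with y hy
      have hy' : g y ^ ((n : ℝ) / m) ≤ 0 := by simpa using hy
      have : g y = 0 := by
        by_contra hne
        exact absurd (Real.rpow_pos_of_pos ((norm_nonneg _).lt_of_ne' hne) _) hy'.not_gt
      simp [this]
  set N := J ^ ((m : ℝ) / n) with hN
  have hNt : N ≠ ⊤ := ENNReal.rpow_ne_top_of_nonneg hmn0.le hJt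
  have hN0 : N ≠ 0 := by simp [hN, ENNReal.rpow_eq_zero_iff, hJ0, hJt]
  have hNr : 0 < N.toReal := ENNReal.toReal_pos hN0 hNt
  have hdiv : ∀ y, ENNReal.ofReal (g y / N.toReal) = N⁻¹ * ENNReal.ofReal (g y) := by
    intro y
    rw [ENNReal.ofReal_div_of_pos hNr, ENNReal.ofReal_toReal hNt, ENNReal.div_eq_inv_mul]
  refine hC₁ (fun y ↦ g y / N.toReal) (by fun_prop)
    (fun y ↦ div_nonneg (norm_nonneg _) hNr.le) ?_ _ u fun x ↦ (hriesz x).trans_eq ?_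
  · have : ∀ y, ENNReal.ofReal ((g y / N.toReal) ^ ((n : ℝ) / m)) =
        J⁻¹ * ENNReal.ofReal (g y ^ ((n : ℝ) / m)) := by
      intro y
      rw [← ENNReal.ofReal_rpow_of_nonneg (div_nonneg (norm_nonneg _) hNr.le) hp0.le, hdiv,
        ENNReal.mul_rpow_of_nonneg _ _ hp0.le, ENNReal.inv_rpow, hJJ,
        ENNReal.ofReal_rpow_of_nonneg (norm_nonneg _) hp0.le]
    simp_rw [this]
    rw [lintegral_const_mul' _ _ (ENNReal.inv_ne_top.2 hJ0), ENNReal.inv_mul_cancel hJ0 hJt]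
  · simp_rw [hdiv, mul_assoc]
    rw [lintegral_const_mul' _ _ (ENNReal.inv_ne_top.2 hN0), ← mul_assoc N,
      ENNReal.mul_inv_cancel hN0 hNt, one_mul]
end

section
/- Let Ω be an open set of finite Lebesgue measure in ℝⁿ, n ≥ 2, let m ∈ ℕ with m < n, and let d ∈ [n−m, n]. Let μ be a finite Borel measure on Ω with sup_{x ∈ ℝⁿ, r > 0} μ(B_r(x) ∩ Ω)/r^d < ∞, and suppose there exist x₀ ∈ Ω and R > 0 such that the closed ball of radius R centered at x₀ is contained in Ω and inf_{r ∈ (0,R]} μ(B_r(x₀) ∩ Ω)/r^d > 0. Let ‖·‖_Z be a rearrangement-invariant function norm on (0,1), and suppose there is a constant C such that ‖ t ↦ u*_μ(μ(Ω)·t) ‖_Z ≤ C Σ_{k=0}^m ∫_Ω |v_{(k)}(x)| dx for every nonnegative function u : ℝⁿ → [0,∞) which is supported in the closed ball of radius R centered at x₀, is continuous on ℝⁿ∖{x₀}, and is m-times weakly differentiable with weak derivatives (v_α)_{|α| ≤ m}, where |v_{(k)}| denotes the Euclidean norm of the vector (v_α)_{|α| = k}. Then there exists a constant C' such that ‖g‖_Z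 ≤ C' ∫₀¹ g*(t) t^{(n−m)/d − 1} dt for every nonnegative measurable g on (0,1), i.e. L^{d/(n−m),1}(0,1) embeds into Z(0,1). (Thus the Lorentz norm L^{d/(n−m),1} is the optimal rearrangement-invariant target norm in the endpoint trace inequality for W^{m,1}.) -/
open MeasureTheory Set
open scoped ENNReal NNReal

/-- Lebesgue measure on the interval `(0,1)`. -/
noncomputable def vol01 : MeasureTheory.Measure ℝ :=
  MeasureTheory.volume.restrict (Set.Ioo 0 1)

/-- The non-increasing rearrangement on `(0,1)` of an extended-nonnegative function. -/
noncomputable def decRearr (f : ℝ → ℝ≥0∞) (s : ℝ) : ℝ≥0∞ :=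
  sInf {ρ : ℝ≥0∞ | vol01 {t | ρ < f t} ≤ ENNReal.ofReal s}

/-- A rearrangement-invariant function norm on `(0,1)`: properties (P1)–(P6). -/
structure IsRINorm (N : (ℝ → ℝ≥0∞) → ℝ≥0∞) : Prop where
  eq_zero_iff : ∀ f : ℝ → ℝ≥0∞, N f = 0 ↔ (∀ᵐ t ∂vol01, f t = 0)
  smul : ∀ (c : ℝ≥0) (f : ℝ → ℝ≥0∞), N (fun t => (c : ℝ≥0∞) * f t) = (c : ℝ≥0∞) * N f
  add_le : ∀ f g : ℝ → ℝ≥0∞, N (fun t => f t + g t) ≤ N f + N g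
  mono : ∀ f g : ℝ → ℝ≥0∞, (∀ᵐ t ∂vol01, f t ≤ g t) → N f ≤ N g
  iSup_eq : ∀ (f : ℕ → ℝ → ℝ≥0∞) (g : ℝ → ℝ≥0∞),
    (∀ k, ∀ᵐ t ∂vol01, f k t ≤ f (k + 1) t) →
    (∀ᵐ t ∂vol01, (⨆ k, f k t) = g t) → N g = ⨆ k, N (f k)
  indicator_lt_top : ∀ E : Set ℝ, MeasurableSet E → E ⊆ Set.Ioo 0 1 → N (E.indicator 1) < ⊤
  exists_integral_le : ∀ E : Set ℝ, MeasurableSet E → E ⊆ Set.Ioo 0 1 →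
    ∃ C : ℝ≥0, ∀ f : ℝ → ℝ≥0∞, (∫⁻ t in E, f t) ≤ (C : ℝ≥0∞) * N f
  rearr_invariant : ∀ f g : ℝ → ℝ≥0∞, decRearr f = decRearr g → N f = N g

/-- The Hardy-type operator `S₁f(t) = ∫_{t^{n/d}}^1 f(s) s^{-1+m/n} ds`. -/
noncomputable def S1 (n m : ℕ) (d : ℝ) (f : ℝ → ℝ≥0∞) (t : ℝ) : ℝ≥0∞ :=
  ∫⁻ s in Set.Ioo (t ^ ((n : ℝ) / d)) 1, ENNReal.ofReal (s ^ ((m : ℝ) / n - 1)) * f s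

/-- The Hardy-type operator
`S₂f(t) = t^{-m/(n-d)} ∫_0^{t^{n/d}} f(s) s^{-1+m/(n-d)} ds`. -/
noncomputable def S2 (n m : ℕ) (d : ℝ) (f : ℝ → ℝ≥0∞) (t : ℝ) : ℝ≥0∞ :=
  ENNReal.ofReal (t ^ (-((m : ℝ) / ((n : ℝ) - d)))) *
    ∫⁻ s in Set.Ioo (0 : ℝ) (t ^ ((n : ℝ) / d)),
      ENNReal.ofReal (s ^ ((m : ℝ) / ((n : ℝ) - d) - 1)) * f s

/-- The iterated partial derivative of `f` in the coordinate directions listed in `L`. -/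
noncomputable def iterPartial {n : ℕ} (f : EuclideanSpace ℝ (Fin n) → ℝ) :
    List (Fin n) → EuclideanSpace ℝ (Fin n) → ℝ
  | [] => f
  | i :: L => fun x => fderiv ℝ (iterPartial f L) x (EuclideanSpace.single i 1)

theorem contDiff_iterPartial {n : ℕ} {f : EuclideanSpace ℝ (Fin n) → ℝ}
    (hf : ContDiff ℝ (⊤ : ℕ∞) f) (L : List (Fin n)) :
    ContDiff ℝ (⊤ : ℕ∞) (iterPartial f L) := by
  induction L with
  | nil => exact hf
  | cons i L ih =>
    exact (ih.fderiv_right (m := (⊤ : ℕ∞)) (by exact_mod_cast le_top)).clm_apply contDiff_const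

theorem tsupport_iterPartial_subset {n : ℕ} (f : EuclideanSpace ℝ (Fin n) → ℝ)
    (L : List (Fin n)) : tsupport (iterPartial f L) ⊆ tsupport f := by
  induction L with
  | nil => exact subset_rfl
  | cons i L ih => exact (tsupport_fderiv_apply_subset ℝ _).trans ih

/-- The iterated partial derivatives of `x ↦ f ((x - x₀) / r)`, expressed through those of `f`. -/
noncomputable def scaledPartial {n : ℕ} (f : EuclideanSpace ℝ (Fin n) → ℝ)
    (x₀ : EuclideanSpace ℝ (Fin n)) (r : ℝ) (L : List (Fin n))
    (x : EuclideanSpace ℝ (Fin n)) : ℝ :=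
  r⁻¹ ^ L.length * iterPartial f L (r⁻¹ • (x - x₀))

theorem contDiff_scaledPartial {n : ℕ} {f : EuclideanSpace ℝ (Fin n) → ℝ}
    (hf : ContDiff ℝ (⊤ : ℕ∞) f) (x₀ : EuclideanSpace ℝ (Fin n)) (r : ℝ) (L : List (Fin n)) :
    ContDiff ℝ (⊤ : ℕ∞) (scaledPartial f x₀ r L) :=
  contDiff_const.mul ((contDiff_iterPartial hf L).comp
    ((contDiff_id.sub contDiff_const).const_smul r⁻¹))

theorem scaledPartial_cons {n : ℕ} {f : EuclideanSpace ℝ (Fin n) → ℝ}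
    (hf : ContDiff ℝ (⊤ : ℕ∞) f) (x₀ : EuclideanSpace ℝ (Fin n)) (r : ℝ) (i : Fin n)
    (L : List (Fin n)) (x : EuclideanSpace ℝ (Fin n)) :
    scaledPartial f x₀ r (i :: L) x =
      fderiv ℝ (scaledPartial f x₀ r L) x (EuclideanSpace.single i 1) := by
  have hd : DifferentiableAt ℝ (iterPartial f L) (r⁻¹ • (x - x₀)) :=
    (contDiff_iterPartial hf L).differentiable (by simp) _
  have hinner : HasFDerivAt (fun y : EuclideanSpace ℝ (Fin n) => r⁻¹ • (y - x₀))
      (r⁻¹ • ContinuousLinearMap.id ℝ (EuclideanSpace ℝ (Fin n))) x :=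
    ((hasFDerivAt_id x).sub_const x₀).const_smul r⁻¹
  have hcomp := (hd.hasFDerivAt.comp x hinner).const_mul (r⁻¹ ^ L.length)
  have hfd : fderiv ℝ (scaledPartial f x₀ r L) x = _ := hcomp.fderiv
  rw [hfd]
  simp [scaledPartial, iterPartial, pow_succ, mul_assoc]

theorem scaledPartial_eq_zero {n : ℕ} {f : EuclideanSpace ℝ (Fin n) → ℝ}
    (hf : tsupport f ⊆ Metric.closedBall 0 1) {x₀ : EuclideanSpace ℝ (Fin n)} {r : ℝ}
    (hr : 0 < r) (L : List (Fin n)) {x : EuclideanSpace ℝ (Fin n)}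
    (hx : x ∉ Metric.closedBall x₀ r) : scaledPartial f x₀ r L x = 0 := by
  have h : r⁻¹ • (x - x₀) ∉ tsupport (iterPartial f L) := by
    intro hmem
    have h1 := hf (tsupport_iterPartial_subset f L hmem)
    rw [mem_closedBall_zero_iff, norm_smul, norm_inv, Real.norm_of_nonneg hr.le,
      inv_mul_le_iff₀ hr, mul_one] at h1
    exact hx (by rwa [mem_closedBall_iff_norm])
  rw [scaledPartial, image_eq_zero_of_notMem_tsupport h, mul_zero]

theorem tsupport_scaledPartial_subset {n : ℕ} {f : EuclideanSpace ℝ (Fin n) → ℝ}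
    (hf : tsupport f ⊆ Metric.closedBall 0 1) (x₀ : EuclideanSpace ℝ (Fin n)) {r : ℝ}
    (hr : 0 < r) (L : List (Fin n)) :
    tsupport (scaledPartial f x₀ r L) ⊆ Metric.closedBall x₀ r :=
  closure_minimal (fun _ hx => by_contra fun h => hx (scaledPartial_eq_zero hf hr L h))
    Metric.isClosed_closedBall

theorem hasCompactSupport_scaledPartial {n : ℕ} {f : EuclideanSpace ℝ (Fin n) → ℝ}
    (hf : tsupport f ⊆ Metric.closedBall 0 1) (x₀ : EuclideanSpace ℝ (Fin n)) {r : ℝ}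
    (hr : 0 < r) (L : List (Fin n)) : HasCompactSupport (scaledPartial f x₀ r L) :=
  (isCompact_closedBall x₀ r).of_isClosed_subset (isClosed_tsupport _)
    (tsupport_scaledPartial_subset hf x₀ hr L)

theorem integral_scaledPartial_mul_fderiv {n : ℕ} {f : EuclideanSpace ℝ (Fin n) → ℝ}
    (hf : ContDiff ℝ (⊤ : ℕ∞) f) (hfs : tsupport f ⊆ Metric.closedBall 0 1)
    (x₀ : EuclideanSpace ℝ (Fin n)) {r : ℝ} (hr : 0 < r) (L : List (Fin n)) (i : Fin n)
    {φ : EuclideanSpace ℝ (Fin n) → ℝ} (hφ : ContDiff ℝ (⊤ : ℕ∞) φ) :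
    (∫ x, scaledPartial f x₀ r L x * fderiv ℝ φ x (EuclideanSpace.single i (1 : ℝ))) =
      -∫ x, scaledPartial f x₀ r (i :: L) x * φ x := by
  have hc := fun K => (contDiff_scaledPartial hf x₀ r K).continuous
  have hs := fun K => hasCompactSupport_scaledPartial hfs x₀ hr K
  have hφ' : Continuous fun x => fderiv ℝ φ x (EuclideanSpace.single i (1 : ℝ)) :=
    (hφ.continuous_fderiv (by simp)).clm_apply continuous_const
  have key := integral_mul_fderiv_eq_neg_fderiv_mul_of_integrable (𝕜 := ℝ)
    (μ := (volume : Measure (EuclideanSpace ℝ (Fin n))))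
    (f := scaledPartial f x₀ r L) (g := φ) (v := EuclideanSpace.single i (1 : ℝ))
    (by
      simp_rw [← scaledPartial_cons hf]
      exact ((hc _).mul hφ.continuous).integrable_of_hasCompactSupport (hs _).mul_right)
    (((hc _).mul hφ').integrable_of_hasCompactSupport (hs _).mul_right)
    (((hc _).mul hφ.continuous).integrable_of_hasCompactSupport (hs _).mul_right)
    (fun x _ => (contDiff_scaledPartial hf x₀ r L).differentiable (by simp) x)
    (fun x _ => hφ.differentiable (by simp) x)
  simp_rw [scaledPartial_cons hf]
  exact key

theorem exists_lintegral_scaledPartial_le {n : ℕ} {f : EuclideanSpace ℝ (Fin n) → ℝ}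
    (hf : ContDiff ℝ (⊤ : ℕ∞) f) (hfs : tsupport f ⊆ Metric.closedBall 0 1)
    (k : ℕ) (hk : k ≤ n) :
    ∃ M : ℝ≥0∞, M < ⊤ ∧ ∀ (x₀ : EuclideanSpace ℝ (Fin n)) (r : ℝ), 0 < r →
      (∫⁻ x, ENNReal.ofReal
        (Real.sqrt (∑ j : Fin k → Fin n, (scaledPartial f x₀ r (List.ofFn j) x) ^ 2))) ≤
        M * ENNReal.ofReal (r ^ (n - k)) := by
  set G : EuclideanSpace ℝ (Fin n) → ℝ := fun x =>
    Real.sqrt (∑ j : Fin k → Fin n, (iterPartial f (List.ofFn j) x) ^ 2) with hG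
  have hGc : Continuous G := Real.continuous_sqrt.comp
    (continuous_finsetSum _ fun j _ => (contDiff_iterPartial hf _).continuous.pow 2)
  have hGs : HasCompactSupport G := by
    refine HasCompactSupport.intro (isCompact_closedBall 0 1) fun x hx => ?_
    have h0 : ∀ L, iterPartial f L x = 0 := fun L =>
      image_eq_zero_of_notMem_tsupport fun h => hx (hfs (tsupport_iterPartial_subset f L h))
    simp [hG, h0]
  obtain ⟨B, hB⟩ := hGs.exists_bound_of_continuous hGc
  refine ⟨ENNReal.ofReal B * volume (Metric.ball (0 : EuclideanSpace ℝ (Fin n)) 1),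
    ENNReal.mul_lt_top ENNReal.ofReal_lt_top measure_ball_lt_top, fun x₀ r hr => ?_⟩
  have hB0 : 0 ≤ B := (norm_nonneg _).trans (hB 0)
  have hpt : ∀ x, ENNReal.ofReal
      (Real.sqrt (∑ j : Fin k → Fin n, (scaledPartial f x₀ r (List.ofFn j) x) ^ 2)) ≤
      (Metric.closedBall x₀ r).indicator (fun _ => ENNReal.ofReal (r⁻¹ ^ k * B)) x := by
    intro x
    by_cases hx : x ∈ Metric.closedBall x₀ r
    · rw [indicator_of_mem hx]
      refine ENNReal.ofReal_le_ofReal ?_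
      simp only [scaledPartial, List.length_ofFn, mul_pow, ← Finset.mul_sum]
      rw [Real.sqrt_mul (by positivity), Real.sqrt_sq (by positivity)]
      exact mul_le_mul_of_nonneg_left ((le_abs_self _).trans (hB _)) (by positivity)
    · simp [scaledPartial_eq_zero hfs hr _ hx]
  refine (lintegral_mono hpt).trans ?_
  rw [lintegral_indicator_const Metric.isClosed_closedBall.measurableSet,
    Measure.addHaar_closedBall _ _ hr.le, finrank_euclideanSpace_fin,
    ENNReal.ofReal_mul (by positivity)]
  have hpow : r⁻¹ ^ k * r ^ n = r ^ (n - k) := by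
    rw [pow_sub₀ r hr.ne' hk, inv_pow, mul_comm]
  rw [← hpow, ENNReal.ofReal_mul (by positivity)]
  apply le_of_eq
  ring

theorem IsRINorm.sum_le {N : (ℝ → ℝ≥0∞) → ℝ≥0∞} (hN : IsRINorm N) (f : ℕ → ℝ → ℝ≥0∞)
    (J : ℕ) : N (fun t => ∑ j ∈ Finset.range J, f j t) ≤ ∑ j ∈ Finset.range J, N (f j) := by
  induction J with
  | zero => simp [(hN.eq_zero_iff _).2]
  | succ J ih =>
    simp only [Finset.sum_range_succ]
    exact (hN.add_le _ _).trans (by gcongr)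

instance : IsProbabilityMeasure vol01 := ⟨by simp [vol01]⟩

theorem vol01_Ioo {s : ℝ} (hs : s ≤ 1) : vol01 (Ioo 0 s) = ENNReal.ofReal s := by
  rw [vol01, Measure.restrict_apply measurableSet_Ioo,
    inter_eq_left.2 (Ioo_subset_Ioo_right hs), Real.volume_Ioo, sub_zero]

theorem toReal_vol01_le_one (E : Set ℝ) : (vol01 E).toReal ≤ 1 := by
  simpa using ENNReal.toReal_mono ENNReal.one_ne_top (prob_le_one (μ := vol01) (s := E))

theorem decRearr_indicator_one_congr {E F : Set ℝ} (h : vol01 E = vol01 F) :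
    decRearr (E.indicator 1) = decRearr (F.indicator 1) := by
  have key : ∀ (A : Set ℝ) (ρ : ℝ≥0∞),
      {t | ρ < A.indicator (1 : ℝ → ℝ≥0∞) t} = if ρ < 1 then A else ∅ := by
    intro A ρ
    ext t
    by_cases ht : t ∈ A <;> by_cases hρ : ρ < 1 <;> simp [ht, hρ]
  funext s
  unfold decRearr
  congr 1
  ext ρ
  simp only [mem_ofPred_eq, key]
  split_ifs <;> simp [h]

theorem IsRINorm.univ_indicator_lt_top {N : (ℝ → ℝ≥0∞) → ℝ≥0∞} (hN : IsRINorm N) :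
    N (univ.indicator 1) < ⊤ := by
  refine (hN.mono _ ((Ioo 0 1).indicator 1) ?_).trans_lt
    (hN.indicator_lt_top _ measurableSet_Ioo subset_rfl)
  filter_upwards [ae_restrict_mem measurableSet_Ioo] with t ht
  simp [ht]

theorem IsRINorm.indicator_mono {N : (ℝ → ℝ≥0∞) → ℝ≥0∞} (hN : IsRINorm N) {E F : Set ℝ}
    (h : E ⊆ F) : N (E.indicator 1) ≤ N (F.indicator 1) :=
  hN.mono _ _ (Filter.Eventually.of_forall fun t =>
    indicator_le_indicator_of_subset h (fun _ => zero_le) t)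

/-- A bound for the fundamental function controls the norm of all characteristic functions. -/
theorem IsRINorm.indicator_le {N : (ℝ → ℝ≥0∞) → ℝ≥0∞} (hN : IsRINorm N) {K : ℝ≥0∞} {q : ℝ}
    (hK : ∀ s : ℝ, 0 < s → s ≤ 1 →
      N ((Ioo 0 s).indicator 1) ≤ K * ENNReal.ofReal (s ^ q)) (E : Set ℝ) :
    N (E.indicator 1) ≤ K * ENNReal.ofReal ((vol01 E).toReal ^ q) := by
  have hE1 := toReal_vol01_le_one E
  rcases (ENNReal.toReal_nonneg (a := vol01 E)).eq_or_lt with h0 | hpos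
  · have hE0 : vol01 E = 0 :=
      ((ENNReal.toReal_eq_zero_iff _).1 h0.symm).resolve_right (measure_ne_top _ _)
    have : N (E.indicator 1) = 0 := by
      rw [hN.eq_zero_iff]
      filter_upwards [measure_eq_zero_iff_ae_notMem.1 hE0] with t ht
      simp [ht]
    simp [this]
  · rw [hN.rearr_invariant _ ((Ioo 0 (vol01 E).toReal).indicator 1)
      (decRearr_indicator_one_congr _)]
    · exact hK _ hpos hE1
    · rw [vol01_Ioo hE1, ENNReal.ofReal_toReal (measure_ne_top _ _)]

theorem le_decRearr {g : ℝ → ℝ≥0∞} {a : ℝ≥0∞} {t : ℝ} (ht : t < (vol01 {x | a < g x}).toReal)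
    (ht0 : 0 ≤ t) : a ≤ decRearr g t := by
  refine le_sInf fun ρ hρ => ?_
  by_contra! hlt
  have h1 : vol01 {x | a < g x} ≤ ENNReal.ofReal t :=
    (measure_mono fun x (hx : a < g x) => hlt.trans hx).trans hρ
  exact absurd (ENNReal.toReal_le_of_le_ofReal ht0 h1) (not_le.2 ht)

theorem sum_indicator_le_min {P : ℕ → Prop} [DecidablePred P] {h y : ℝ≥0∞}
    (hP : ∀ j, P j → ((j + 1 : ℕ) : ℝ≥0∞) * h ≤ y) (J : ℕ) :
    ∑ j ∈ Finset.range J, (if P j then h else 0) ≤ min y (J * h) := by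
  induction J with
  | zero => simp
  | succ J ih =>
    rw [Finset.sum_range_succ]
    split_ifs with hJ
    · have h1 : ∑ j ∈ Finset.range J, (if P j then h else 0) + h ≤ ((J + 1 : ℕ) : ℝ≥0∞) * h := by
        push_cast
        rw [add_mul, one_mul]
        gcongr
        exact ih.trans (min_le_right _ _)
      exact le_min (h1.trans (hP J hJ)) h1
    · rw [add_zero]
      refine ih.trans (min_le_min_left _ ?_)
      gcongr
      simp

theorem min_le_sum_indicator (h y : ℝ≥0∞) (J : ℕ) :
    min y (J * h) ≤ ∑ j ∈ Finset.range J, (if (j : ℝ≥0∞) * h < y then h else 0) := by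
  induction J with
  | zero => simp
  | succ J ih =>
    rw [Finset.sum_range_succ]
    split_ifs with hJ
    · rw [min_eq_right hJ.le] at ih
      refine (min_le_right _ _).trans ?_
      push_cast
      rw [add_mul, one_mul]
      gcongr
    · rw [add_zero]
      rw [min_eq_left (not_lt.1 hJ)] at ih
      exact (min_le_left _ _).trans ih

theorem lintegral_Ioo_rpow_sub_one {q s : ℝ} (hq : 0 < q) (hs : 0 ≤ s) :
    ∫⁻ t in Ioo 0 s, ENNReal.ofReal (t ^ (q - 1)) = ENNReal.ofReal (s ^ q / q) := by
  have hi : IntervalIntegrable (fun t : ℝ => t ^ (q - 1)) volume 0 s :=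
    intervalIntegral.intervalIntegrable_rpow' (by linarith)
  rw [restrict_Ioo_eq_restrict_Ioc,
    ← ofReal_integral_eq_lintegral_ofReal
      ((intervalIntegrable_iff_integrableOn_Ioc_of_le hs).1 hi),
    ← intervalIntegral.integral_of_le hs, integral_rpow (Or.inl (by linarith))]
  · simp [Real.zero_rpow hq.ne']
  · filter_upwards [ae_restrict_mem measurableSet_Ioc] with t ht
    exact Real.rpow_nonneg ht.1.le _

theorem sum_rpow_le_lintegral_decRearr {q : ℝ} (hq : 0 < q) (g : ℝ → ℝ≥0∞) (h : ℝ≥0∞) (J : ℕ) :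
    ∑ j ∈ Finset.range J,
      h * ENNReal.ofReal ((vol01 {t | ((j + 1 : ℕ) : ℝ≥0∞) * h < g t}).toReal ^ q / q) ≤
      ∫⁻ t in Ioo (0 : ℝ) 1, decRearr g t * ENNReal.ofReal (t ^ (q - 1)) := by
  classical
  let l : ℕ → ℝ := fun j => (vol01 {t | ((j + 1 : ℕ) : ℝ≥0∞) * h < g t}).toReal
  have hl1 : ∀ j, l j ≤ 1 := fun j => toReal_vol01_le_one _
  have hw : Measurable fun t : ℝ => ENNReal.ofReal (t ^ (q - 1)) := by fun_prop
  have hterm : ∀ j, h * ENNReal.ofReal (l j ^ q / q) =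
      ∫⁻ t in Ioo (0 : ℝ) 1, (if t < l j then h else 0) * ENNReal.ofReal (t ^ (q - 1)) := by
    intro j
    rw [← lintegral_Ioo_rpow_sub_one hq ENNReal.toReal_nonneg, ← lintegral_const_mul _ hw,
      ← lintegral_indicator measurableSet_Ioo, ← lintegral_indicator measurableSet_Ioo]
    congr 1 with t
    have h2 : t < l j → t < 1 := fun h1 => h1.trans_le (hl1 j)
    change (Ioo 0 (l j)).indicator _ t = _
    generalize l j = y at h2 ⊢
    by_cases h1 : t < y
    · simp [indicator, h1, h2 h1]
    · simp [indicator, h1]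
  change ∑ j ∈ Finset.range J, h * ENNReal.ofReal (l j ^ q / q) ≤ _
  simp_rw [hterm]
  rw [← lintegral_finsetSum']
  · refine setLIntegral_mono' measurableSet_Ioo fun t ht => ?_
    rw [← Finset.sum_mul]
    gcongr
    exact (sum_indicator_le_min (fun j hj => le_decRearr hj ht.1.le) J).trans (min_le_left _ _)
  · intro j _
    exact ((Measurable.ite measurableSet_Iio measurable_const measurable_const).mul hw).aemeasurable

/-- A rearrangement-invariant norm whose fundamental function is at most a multiple of `s ^ q`
is dominated by the Lorentz `L^{1/q,1}` norm. -/
theorem IsRINorm.le_lorentz {N : (ℝ → ℝ≥0∞) → ℝ≥0∞} (hN : IsRINorm N) {K : ℝ≥0∞} {q : ℝ}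
    (hq : 0 < q) (hK : ∀ s : ℝ, 0 < s → s ≤ 1 →
      N ((Ioo 0 s).indicator 1) ≤ K * ENNReal.ofReal (s ^ q)) (g : ℝ → ℝ≥0∞) :
    N g ≤ K * ENNReal.ofReal q *
      ∫⁻ t in Ioo (0 : ℝ) 1, decRearr g t * ENNReal.ofReal (t ^ (q - 1)) := by
  set I := ∫⁻ t in Ioo (0 : ℝ) 1, decRearr g t * ENNReal.ofReal (t ^ (q - 1)) with hI
  have hN1 := hN.univ_indicator_lt_top
  have hstep : ∀ h : ℝ≥0, 0 < h →
      N g ≤ h * N (univ.indicator 1) + K * ENNReal.ofReal q * I := by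
    intro h hh
    have htrunc : ∀ J : ℕ, N (fun t => min (g t) (J * h)) ≤
        h * N (univ.indicator 1) + K * ENNReal.ofReal q * I := by
      intro J
      calc N (fun t => min (g t) (J * h))
          ≤ N (fun t => min (g t) ((J + 1 : ℕ) * h)) := by
            refine hN.mono _ _ (Filter.Eventually.of_forall fun t => min_le_min_left _ ?_)
            gcongr
            simp
        _ ≤ N (fun t => ∑ j ∈ Finset.range (J + 1),
              (h : ℝ≥0∞) * {x | (j : ℝ≥0∞) * h < g x}.indicator 1 t) := by
            refine hN.mono _ _ (Filter.Eventually.of_forall fun t =>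
              (min_le_sum_indicator _ _ _).trans (le_of_eq ?_))
            refine Finset.sum_congr rfl fun j _ => ?_
            by_cases hj : (j : ℝ≥0∞) * h < g t <;> simp [hj]
        _ ≤ ∑ j ∈ Finset.range (J + 1),
              (h : ℝ≥0∞) * N ({x | (j : ℝ≥0∞) * h < g x}.indicator 1) := by
            refine (hN.sum_le _ _).trans (le_of_eq ?_)
            exact Finset.sum_congr rfl fun j _ => hN.smul _ _
        _ ≤ ∑ j ∈ Finset.range J, K * ENNReal.ofReal q * (h *
              ENNReal.ofReal ((vol01 {t | ((j + 1 : ℕ) : ℝ≥0∞) * h < g t}).toReal ^ q / q)) +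
              h * N (univ.indicator 1) := by
            rw [Finset.sum_range_succ']
            refine add_le_add (Finset.sum_le_sum fun j _ => ?_) (mul_le_mul_right ?_ _)
            · refine (mul_le_mul_right (hN.indicator_le hK _) _).trans (le_of_eq ?_)
              rw [mul_left_comm (h : ℝ≥0∞), mul_assoc K, mul_left_comm (ENNReal.ofReal q),
                ← ENNReal.ofReal_mul hq.le, mul_div_cancel₀ _ hq.ne']
            · exact hN.indicator_mono (subset_univ _)
        _ ≤ h * N (univ.indicator 1) + K * ENNReal.ofReal q * I := by
            rw [← Finset.mul_sum, add_comm]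
            gcongr
            exact sum_rpow_le_lintegral_decRearr hq g h J
    rw [hN.iSup_eq (fun J t => min (g t) (J * h)) g]
    · exact iSup_le htrunc
    · refine fun J => Filter.Eventually.of_forall fun t => min_le_min_left _ ?_
      gcongr
      simp
    · refine Filter.Eventually.of_forall fun t => ?_
      have hsup : (⨆ J : ℕ, (J : ℝ≥0∞) * h) = ⊤ := by
        rw [← ENNReal.iSup_mul, ENNReal.iSup_natCast, ENNReal.top_mul (by simpa using hh.ne')]
      change (⨆ J : ℕ, g t ⊓ ((J : ℝ≥0∞) * h)) = g t
      rw [← inf_iSup_eq, hsup, inf_top_eq]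
  lift N (univ.indicator 1) to ℝ≥0 using hN1.ne with c
  refine ENNReal.le_of_forall_pos_le_add fun ε hε _ => ?_
  refine (hstep (ε / (c + 1)) (by positivity)).trans ?_
  rw [add_comm]
  gcongr
  rw [← ENNReal.coe_mul, ENNReal.coe_le_coe, div_mul_eq_mul_div]
  exact div_le_of_le_mul₀ (by positivity) (by positivity)
    (mul_le_mul_of_nonneg_left (le_add_of_nonneg_right zero_le_one) (zero_le))

/-- A power bound for the fundamental function near `0` extends to the whole of `(0, 1]`. -/
theorem IsRINorm.exists_fundamental_le {N : (ℝ → ℝ≥0∞) → ℝ≥0∞} (hN : IsRINorm N) {K : ℝ≥0∞}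
    (hKtop : K < ⊤) {a q : ℝ} (ha : 0 < a) (hq : 0 < q)
    (hK : ∀ s : ℝ, 0 < s → s ≤ 1 →
      N ((Ioo 0 (a * s)).indicator 1) ≤ K * ENNReal.ofReal (s ^ q)) :
    ∃ K' : ℝ≥0∞, K' < ⊤ ∧ ∀ s : ℝ, 0 < s → s ≤ 1 →
      N ((Ioo 0 s).indicator 1) ≤ K' * ENNReal.ofReal (s ^ q) := by
  refine ⟨(K + N (univ.indicator 1)) * ENNReal.ofReal (a ^ q)⁻¹, ENNReal.mul_lt_top
    (ENNReal.add_lt_top.2 ⟨hKtop, hN.univ_indicator_lt_top⟩) ENNReal.ofReal_lt_top,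
    fun s hs _ => ?_⟩
  rw [mul_assoc, ← ENNReal.ofReal_mul (by positivity), inv_mul_eq_div,
    ← Real.div_rpow hs.le ha.le]
  rcases le_total s a with hsa | hsa
  · have h1 := hK (s / a) (by positivity) ((div_le_one ha).2 hsa)
    rw [mul_div_cancel₀ _ ha.ne'] at h1
    refine h1.trans ?_
    gcongr
    exact le_self_add
  · have h1 : (1 : ℝ≥0∞) ≤ ENNReal.ofReal ((s / a) ^ q) :=
      ENNReal.one_le_ofReal.2 (Real.one_le_rpow ((one_le_div ha).2 hsa) hq.le)
    calc N ((Ioo 0 s).indicator 1) ≤ N (univ.indicator 1) * 1 := by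
          rw [mul_one]
          exact hN.indicator_mono (subset_univ _)
      _ ≤ _ := mul_le_mul' le_add_self h1

theorem one_le_rearr {α : Type*} [MeasurableSpace α] {ν : Measure α} {u : α → ℝ} {E : Set α}
    (hu : ∀ x ∈ E, u x = 1) {s : ℝ} (hs : ENNReal.ofReal s < ν E) : 1 ≤ rearr ν u s := by
  refine le_sInf fun ρ hρ => ?_
  by_contra! hlt
  refine absurd ((measure_mono fun x hx => ?_).trans hρ) (not_le.2 hs)
  change ρ < ENNReal.ofReal |u x|
  simpa [hu x hx] using hlt

/-- **Optimality of the Lorentz norm `L^{d/(n-m),1}` in the endpoint `W^{m,1}` trace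
inequality:** if a rearrangement-invariant norm `Z` satisfies the trace inequality
`‖u‖_{Z(Ω,μ)} ≤ C ‖u‖_{W^{m,1}(Ω)}` for all admissible test functions, and `μ` decays
exactly like `r^d` at some point, then `L^{d/(n-m),1}(0,1) → Z(0,1)`. -/
theorem optimality_endpoint_L1 (n m : ℕ) (hn : 2 ≤ n) (hm : 1 ≤ m) (hmn : m < n)
    (d : ℝ) (hd1 : (n : ℝ) - m ≤ d) (hd2 : d ≤ n)
    (Ω : Set (EuclideanSpace ℝ (Fin n))) (hΩ : IsOpen Ω) (hΩvol : volume Ω < ⊤)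
    (NZ : (ℝ → ℝ≥0∞) → ℝ≥0∞) (hZ : IsRINorm NZ)
    (μ : Measure (EuclideanSpace ℝ (Fin n))) (hfin : IsFiniteMeasure μ) (hsupp : μ Ωᶜ = 0)
    (hFrostman : ∃ A : ℝ, ∀ (x : EuclideanSpace ℝ (Fin n)) (r : ℝ), 0 < r →
        μ (Metric.ball x r ∩ Ω) ≤ ENNReal.ofReal (A * r ^ d))
    (x₀ : EuclideanSpace ℝ (Fin n)) (R : ℝ) (hR : 0 < R)
    (hball : Metric.closedBall x₀ R ⊆ Ω)
    (hlower : ∃ c : ℝ, 0 < c ∧ ∀ r : ℝ, 0 < r → r ≤ R →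
        ENNReal.ofReal (c * r ^ d) ≤ μ (Metric.ball x₀ r ∩ Ω))
    (C : ℝ)
    (hSob : ∀ (u : EuclideanSpace ℝ (Fin n) → ℝ)
        (v : List (Fin n) → EuclideanSpace ℝ (Fin n) → ℝ),
        (∀ x, 0 ≤ u x) → tsupport u ⊆ Metric.closedBall x₀ R →
        ContinuousOn u {x₀}ᶜ →
        v [] = u →
        (∀ L : List (Fin n), L.length ≤ m → LocallyIntegrable (v L) volume) →
        (∀ L : List (Fin n), L.length < m → ∀ i : Fin n,
          ∀ φ : EuclideanSpace ℝ (Fin n) → ℝ, ContDiff ℝ (⊤ : ℕ∞) φ →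
            HasCompactSupport φ →
            (∫ x, v L x * fderiv ℝ φ x (EuclideanSpace.single i (1 : ℝ))) =
              -∫ x, v (i :: L) x * φ x) →
        NZ (fun t => rearr μ u ((μ Ω).toReal * t)) ≤
          ENNReal.ofReal C *
            ∑ k ∈ Finset.range (m + 1),
              ∫⁻ x in Ω, ENNReal.ofReal
                (Real.sqrt (∑ j : Fin k → Fin n, (v (List.ofFn j) x) ^ 2))) :
    ∃ C' : ℝ, ∀ g : ℝ → ℝ≥0∞, Measurable g →
      NZ g ≤ ENNReal.ofReal C' *
        ∫⁻ t in Set.Ioo (0 : ℝ) 1,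
          decRearr g t * ENNReal.ofReal (t ^ (((n : ℝ) - m) / d - 1)) := by
  obtain ⟨c, hc, hlow⟩ := hlower
  have hmn' : (0 : ℝ) < (n : ℝ) - m := by
    rw [sub_pos]
    exact_mod_cast hmn
  have hd : 0 < d := hmn'.trans_le hd1
  set q : ℝ := ((n : ℝ) - m) / d with hq_def
  have hq : 0 < q := div_pos hmn' hd
  have hμΩ : 0 < (μ Ω).toReal := by
    refine ENNReal.toReal_pos (fun h => ?_) (measure_ne_top _ _)
    have h1 := (hlow R hR le_rfl).trans (measure_mono inter_subset_right)
    rw [h, nonpos_iff_eq_zero, ENNReal.ofReal_eq_zero] at h1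
    exact absurd h1 (not_le.2 (by positivity))
  let b : ContDiffBump (0 : EuclideanSpace ℝ (Fin n)) :=
    ⟨1 / 2, 1, by norm_num, by norm_num⟩
  have hb : ContDiff ℝ (⊤ : ℕ∞) b := b.contDiff
  have hbs : tsupport b ⊆ Metric.closedBall 0 1 := b.tsupport_eq.le
  have hM := fun k : ℕ => fun hk : k ≤ n => exists_lintegral_scaledPartial_le hb hbs k hk
  choose! M hMtop hM using hM
  set K : ℝ≥0∞ := ENNReal.ofReal C *
    ∑ k ∈ Finset.range (m + 1), M k * ENNReal.ofReal (R ^ (n - k)) with hK_def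
  have hKtop : K < ⊤ := by
    refine ENNReal.mul_lt_top ENNReal.ofReal_lt_top (ENNReal.sum_lt_top.2 fun k hk => ?_)
    have hkn : k ≤ n := by
      have := Finset.mem_range.1 hk
      omega
    exact ENNReal.mul_lt_top (hMtop k hkn) ENNReal.ofReal_lt_top
  set a : ℝ := c * (R / 2) ^ d / (μ Ω).toReal with ha_def
  have ha : 0 < a := by positivity
  have hsmall : ∀ s : ℝ, 0 < s → s ≤ 1 →
      NZ ((Ioo 0 (a * s)).indicator 1) ≤ K * ENNReal.ofReal (s ^ q) := by
    intro s hs hs1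
    set τ : ℝ := s ^ d⁻¹ with hτ_def
    have hτ : 0 < τ := by positivity
    have hτ1 : τ ≤ 1 := Real.rpow_le_one hs.le hs1 (by positivity)
    have hτd : τ ^ d = s := Real.rpow_inv_rpow hs.le hd.ne'
    have hτq : τ ^ (n - m) = s ^ q := by
      rw [← Real.rpow_natCast, hτ_def, ← Real.rpow_mul hs.le, Nat.cast_sub hmn.le,
        inv_mul_eq_div]
    have hr : 0 < R * τ := by positivity
    have hrR : R * τ ≤ R := mul_le_of_le_one_right hR.le hτ1
    have hcont := fun L => (contDiff_scaledPartial hb x₀ (R * τ) L).continuous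
    have hS := hSob (scaledPartial b x₀ (R * τ) []) (scaledPartial b x₀ (R * τ))
      (fun x => by simpa [scaledPartial, iterPartial] using b.nonneg)
      ((tsupport_scaledPartial_subset hbs x₀ hr []).trans (Metric.closedBall_subset_closedBall hrR))
      (hcont []).continuousOn rfl (fun L _ => (hcont L).locallyIntegrable)
      (fun L _ i φ hφ _ => integral_scaledPartial_mul_fderiv hb hbs x₀ hr L i hφ)
    have hone : ∀ x ∈ Metric.ball x₀ (R * τ / 2) ∩ Ω, scaledPartial b x₀ (R * τ) [] x = 1 := by
      rintro x ⟨hx, -⟩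
      simp only [scaledPartial, iterPartial, List.length_nil, pow_zero, one_mul]
      refine b.one_of_mem_closedBall ?_
      rw [mem_closedBall_zero_iff, norm_smul, norm_inv, Real.norm_of_nonneg hr.le,
        inv_mul_le_iff₀ hr]
      rw [mem_ball_iff_norm] at hx
      change _ ≤ R * τ * (1 / 2)
      linarith
    have hrearr : NZ ((Ioo 0 (a * s)).indicator 1) ≤
        NZ (fun t => rearr μ (scaledPartial b x₀ (R * τ) []) ((μ Ω).toReal * t)) := by
      refine hZ.mono _ _ (Filter.Eventually.of_forall fun t => ?_)
      by_cases ht : t ∈ Ioo 0 (a * s)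
      · rw [indicator_of_mem ht]
        refine one_le_rearr hone (lt_of_lt_of_le ?_ (hlow (R * τ / 2) (by positivity) (by linarith)))
        rw [ENNReal.ofReal_lt_ofReal_iff (by positivity)]
        have h1 : R * τ / 2 = R / 2 * τ := by ring
        rw [h1, Real.mul_rpow (by positivity) hτ.le, hτd]
        calc (μ Ω).toReal * t < (μ Ω).toReal * (a * s) := mul_lt_mul_of_pos_left ht.2 hμΩ
          _ = c * ((R / 2) ^ d * s) := by
            rw [ha_def]
            field_simp
      · rw [indicator_of_notMem ht]
        exact zero_le
    refine hrearr.trans (hS.trans ?_)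
    rw [hK_def, mul_assoc, Finset.sum_mul]
    gcongr with k hk
    have hkm : k ≤ m := Nat.lt_succ_iff.1 (Finset.mem_range.1 hk)
    refine (setLIntegral_le_lintegral _ _).trans ((hM k (hkm.trans hmn.le) x₀ _ hr).trans ?_)
    rw [mul_pow, ENNReal.ofReal_mul (by positivity), ← mul_assoc, ← hτq]
    exact mul_le_mul_right (ENNReal.ofReal_le_ofReal
      (pow_le_pow_of_le_one hτ.le hτ1 (by omega))) _
  obtain ⟨K', hK'top, hK'⟩ := hZ.exists_fundamental_le hKtop ha hq hsmall
  refine ⟨(K' * ENNReal.ofReal q).toReal, fun g _ => ?_⟩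
  rw [ENNReal.ofReal_toReal (ENNReal.mul_lt_top hK'top ENNReal.ofReal_lt_top).ne]
  exact hZ.le_lorentz hq hK' g
end
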